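/- arXiv:2111.00693 — 2 statements merged into one kernel-verified Lean document; each statement's English description precedes it below -/
import Mathlib

section
/- Let ℬ be a Markushevich basis of 𝕏, 0 < s ≤ 1, and let w and w′ be equivalent weights, i.e., there are constants 0 < c₁ ≤ c₂ < ∞ with c₁·w_n ≤ w′_n ≤ c₂·w_n for all n ∈ ℕ. Then ℬ is s-w-almost semi-greedy if and only if ℬ is s-w′-almost semi-greedy. -/
open scoped BigOperators ENNReal
open Filter

noncomputable section

namespace GreedyPaper

variable {𝕜 : Type*} [RCLike 𝕜] {X : Type*} [NormedAddCommGroup X] [NormedSpace 𝕜 X]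

/-- Support of `x` with respect to the coordinate functionals `f`. -/
def msupp (f : ℕ → X →L[𝕜] 𝕜) (x : X) : Set ℕ := {i | f i x ≠ 0}

/-- Projection onto a finite set of coordinates. -/
def proj (e : ℕ → X) (f : ℕ → X →L[𝕜] 𝕜) (A : Finset ℕ) (x : X) : X :=
  ∑ i ∈ A, f i x • e i

/-- `A` is an `m`-`t`-greedy set for `x`: `|A| = m` and
`min_{j ∈ A} |f j x| ≥ t · sup_{k ∉ A} |f k x|`. -/
def GreedySet (f : ℕ → X →L[𝕜] 𝕜) (x : X) (m : ℕ) (t : ℝ) (A : Finset ℕ) : Prop :=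
  A.card = m ∧ ∀ j ∈ A, ∀ k ∉ A, t * ‖f k x‖ ≤ ‖f j x‖

/-- `w`-measure of a set of indices, with value in `ℝ≥0∞` (possibly infinite). -/
def wsum (w : ℕ → ℝ) (S : Set ℕ) : ℝ≥0∞ := ∑' i : S, ENNReal.ofReal (w i)

/-- Sign of a scalar: `sgn 0 = 1` and `sgn t * t = |t|`. -/
def sgn (t : 𝕜) : 𝕜 := if t = 0 then 1 else (‖t‖ : 𝕜) / t

/-- A Markushevich basis (with the boundedness assumptions of the paper):
biorthogonality, dense span, totality of the coordinate functionals, and boundedness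
of both the basis vectors and the coordinate functionals. -/
structure IsMarkushevichBasis (e : ℕ → X) (f : ℕ → X →L[𝕜] 𝕜) : Prop where
  biorth : ∀ i j, f i (e j) = if i = j then 1 else 0
  dense_span : Dense ((Submodule.span 𝕜 (Set.range e) : Submodule 𝕜 X) : Set X)
  total : ∀ x : X, (∀ i, f i x = 0) → x = 0
  bddE : BddAbove (Set.range fun i => ‖e i‖)
  bddF : BddAbove (Set.range fun i => ‖f i‖)

/-- `ℬ` is `C`-`s`-`w`-semi-greedy: for every `x` and `m` there are an `m`-`s`-greedy set `A`
and `y` supported in `A` with `‖x - y‖ ≤ C · inf {‖x - z‖ : supp z finite, w(supp z) ≤ w(A)}`. -/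
def SemiGreedy (e : ℕ → X) (f : ℕ → X →L[𝕜] 𝕜) (w : ℕ → ℝ) (C s : ℝ) : Prop :=
  ∀ (x : X) (m : ℕ), ∃ A : Finset ℕ, GreedySet f x m s A ∧
    ∃ y : X, msupp f y ⊆ (A : Set ℕ) ∧
      ∀ z : X, (msupp f z).Finite → wsum w (msupp f z) ≤ wsum w (A : Set ℕ) →
        ‖x - y‖ ≤ C * ‖x - z‖

/-- `ℬ` is `C`-`s`-`w`-almost semi-greedy. -/
def AlmostSemiGreedy (e : ℕ → X) (f : ℕ → X →L[𝕜] 𝕜) (w : ℕ → ℝ) (C s : ℝ) : Prop :=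
  ∀ (x : X) (m : ℕ), ∃ A : Finset ℕ, GreedySet f x m s A ∧
    ∃ y : X, msupp f y ⊆ (A : Set ℕ) ∧
      ∀ B : Finset ℕ, wsum w (B : Set ℕ) ≤ wsum w (A : Set ℕ) →
        ‖x - y‖ ≤ C * ‖x - proj e f B x‖

/-- `ℬ` is `C`-`w`-almost greedy. -/
def AlmostGreedy (e : ℕ → X) (f : ℕ → X →L[𝕜] 𝕜) (w : ℕ → ℝ) (C : ℝ) : Prop :=
  ∀ (x : X) (m : ℕ) (A : Finset ℕ), GreedySet f x m 1 A →
    ∀ B : Finset ℕ, wsum w (B : Set ℕ) ≤ wsum w (A : Set ℕ) →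
      ‖x - proj e f A x‖ ≤ C * ‖x - proj e f B x‖

/-- `ℬ` is `C`-`w`-disjoint almost greedy. -/
def DisjointAlmostGreedy (e : ℕ → X) (f : ℕ → X →L[𝕜] 𝕜) (w : ℕ → ℝ) (C : ℝ) : Prop :=
  ∀ (x : X) (m : ℕ) (A : Finset ℕ), GreedySet f x m 1 A →
    ∀ B : Finset ℕ, wsum w (B : Set ℕ) ≤ wsum w (A : Set ℕ) → Disjoint B A →
      ‖x - proj e f A x‖ ≤ C * ‖x - proj e f B x‖

/-- `ℬ` is `C`-`s`-`w`-almost greedy in the weak sense. -/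
def WeakAlmostGreedy (e : ℕ → X) (f : ℕ → X →L[𝕜] 𝕜) (w : ℕ → ℝ) (C s : ℝ) : Prop :=
  ∀ (x : X) (m : ℕ), ∃ A : Finset ℕ, GreedySet f x m s A ∧
    ∀ B : Finset ℕ, wsum w (B : Set ℕ) ≤ wsum w (A : Set ℕ) →
      ‖x - proj e f A x‖ ≤ C * ‖x - proj e f B x‖

/-- `ℬ` is `C`-`w`-superdemocratic. -/
def SuperDemocratic (e : ℕ → X) (f : ℕ → X →L[𝕜] 𝕜) (w : ℕ → ℝ) (C : ℝ) : Prop :=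
  ∀ (A B : Finset ℕ) (ε ε' : ℕ → 𝕜), (∀ i ∈ A, ‖ε i‖ = 1) → (∀ i ∈ B, ‖ε' i‖ = 1) →
    wsum w (A : Set ℕ) ≤ wsum w (B : Set ℕ) →
      ‖∑ i ∈ A, ε i • e i‖ ≤ C * ‖∑ i ∈ B, ε' i • e i‖

/-- `ℬ` is `C`-`w`-democratic. -/
def Democratic (e : ℕ → X) (f : ℕ → X →L[𝕜] 𝕜) (w : ℕ → ℝ) (C : ℝ) : Prop :=
  ∀ A B : Finset ℕ, wsum w (A : Set ℕ) ≤ wsum w (B : Set ℕ) →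
    ‖∑ i ∈ A, e i‖ ≤ C * ‖∑ i ∈ B, e i‖

/-- `ℬ` is `C`-truncation quasi-greedy. -/
def TruncationQuasiGreedy (e : ℕ → X) (f : ℕ → X →L[𝕜] 𝕜) (C : ℝ) : Prop :=
  ∀ (x : X) (m : ℕ) (A : Finset ℕ) (hA : A.Nonempty), GreedySet f x m 1 A →
    (A.inf' hA fun i => ‖f i x‖) * ‖∑ i ∈ A, sgn (f i x) • e i‖ ≤ C * ‖x‖

/-- `ℬ` has the `C`-`w`-Property (A). -/
def PropertyA (e : ℕ → X) (f : ℕ → X →L[𝕜] 𝕜) (w : ℕ → ℝ) (C : ℝ) : Prop :=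
  ∀ x : X, (∀ i, ‖f i x‖ ≤ 1) →
    ∀ A B : Finset ℕ, wsum w (A : Set ℕ) ≤ wsum w (B : Set ℕ) → Disjoint A B →
      (∀ i ∈ A ∪ B, f i x = 0) →
      ∀ ε ε' : ℕ → 𝕜, (∀ i ∈ A, ‖ε i‖ = 1) → (∀ i ∈ B, ‖ε' i‖ = 1) →
        ‖x + ∑ i ∈ A, ε i • e i‖ ≤ C * ‖x + ∑ i ∈ B, ε' i • e i‖

/-- The finite dimensional separation property (FDSP) with constant `M`. -/
def FDSP (e : ℕ → X) (M : ℝ) : Prop :=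
  ∀ Z : Submodule 𝕜 X, IsClosed (Z : Set X) → TopologicalSpace.IsSeparable (Z : Set X) →
    ∀ ε : ℝ, 0 < ε → ∃ k : ℕ → ℕ, StrictMono k ∧
      (∀ (a : ℕ → 𝕜) (n l : ℕ), n ≤ l →
        ‖∑ j ∈ Finset.range (n + 1), a j • e (k j)‖ ≤
          (M + ε) * ‖∑ j ∈ Finset.range (l + 1), a j • e (k j)‖) ∧
      (∀ F : Submodule 𝕜 X, F ≤ Z → FiniteDimensional 𝕜 F →
        ∃ N : ℕ, ∀ x ∈ F,
          ∀ z ∈ closure ((Submodule.span 𝕜 {v : X | ∃ n, N < n ∧ v = e (k n)} :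
              Submodule 𝕜 X) : Set X),
            ‖x‖ ≤ (M + ε) * ‖x + z‖)

/-- `v` is a block basis of `e`. -/
def IsBlockBasis (e v : ℕ → X) : Prop :=
  ∃ (b : ℕ → 𝕜) (n m : ℕ → ℕ), (∀ i, n i ≤ m i) ∧ (∀ i, m i < n (i + 1)) ∧
    (∀ i, v i = ∑ k ∈ Finset.Icc (n i) (m i), b k • e k) ∧
    (∀ i, ∃ k ∈ Finset.Icc (n i) (m i), b k ≠ 0)

/-! ### Coordinates and weights -/

theorem wsum_coe_finset {w : ℕ → ℝ} (hw : ∀ i, 0 < w i) (A : Finset ℕ) :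
    wsum w (A : Set ℕ) = ENNReal.ofReal (∑ i ∈ A, w i) := by
  rw [wsum, Finset.tsum_subtype' A fun i => ENNReal.ofReal (w i),
    ENNReal.ofReal_sum_of_nonneg fun i _ => (hw i).le]

theorem wsum_le_wsum_iff {w : ℕ → ℝ} (hw : ∀ i, 0 < w i) (A B : Finset ℕ) :
    wsum w (A : Set ℕ) ≤ wsum w (B : Set ℕ) ↔ ∑ i ∈ A, w i ≤ ∑ i ∈ B, w i := by
  rw [wsum_coe_finset hw, wsum_coe_finset hw,
    ENNReal.ofReal_le_ofReal_iff (Finset.sum_nonneg fun i _ => (hw i).le)]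

theorem GreedySet.mono {f : ℕ → X →L[𝕜] 𝕜} {x : X} {m : ℕ} {s t : ℝ} {A : Finset ℕ}
    (h : GreedySet f x m t A) (hst : s ≤ t) : GreedySet f x m s A :=
  ⟨h.1, fun j hj k hk =>
    (mul_le_mul_of_nonneg_right hst (norm_nonneg _)).trans (h.2 j hj k hk)⟩

theorem norm_sum_smul_le {e : ℕ → X} {B c : ℝ} (hB : ∀ i, ‖e i‖ ≤ B) (hc : 0 ≤ c)
    (A : Finset ℕ) (a : ℕ → 𝕜) (ha : ∀ i ∈ A, ‖a i‖ ≤ c) :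
    ‖∑ i ∈ A, a i • e i‖ ≤ A.card * (c * B) := by
  refine (norm_sum_le _ _).trans ?_
  rw [← nsmul_eq_mul]
  refine Finset.sum_le_card_nsmul _ _ _ fun i hi => ?_
  rw [norm_smul]
  exact mul_le_mul (ha i hi) (hB i) (norm_nonneg _) hc

namespace IsMarkushevichBasis

variable {e : ℕ → X} {f : ℕ → X →L[𝕜] 𝕜}

theorem apply_sum (h : IsMarkushevichBasis e f) (A : Finset ℕ) (a : ℕ → 𝕜) (i : ℕ) :
    f i (∑ j ∈ A, a j • e j) = if i ∈ A then a i else 0 := by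
  simp [map_sum, h.biorth]

theorem exists_bound (h : IsMarkushevichBasis e f) :
    ∃ B : ℝ, 0 < B ∧ (∀ i, ‖e i‖ ≤ B) ∧ ∀ i, ‖f i‖ ≤ B := by
  obtain ⟨b, hb⟩ := h.bddE
  obtain ⟨c, hc⟩ := h.bddF
  exact ⟨max 1 (max b c), by positivity,
    fun i => (hb ⟨i, rfl⟩).trans (by simp), fun i => (hc ⟨i, rfl⟩).trans (by simp)⟩

theorem eq_sum_of_msupp_subset (h : IsMarkushevichBasis e f) {y : X} {A : Finset ℕ}
    (hy : msupp f y ⊆ (A : Set ℕ)) : y = ∑ i ∈ A, f i y • e i := by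
  rw [← sub_eq_zero]
  refine h.total _ fun i => ?_
  rw [map_sub, h.apply_sum]
  split_ifs with hi
  · simp
  · have : f i y = 0 := by
      by_contra hne
      exact hi (hy hne)
    simp [this]

theorem msupp_sum_subset (h : IsMarkushevichBasis e f) (A : Finset ℕ) (a : ℕ → 𝕜) :
    msupp f (∑ j ∈ A, a j • e j) ⊆ (A : Set ℕ) := by
  intro i hi
  by_contra hA
  exact hi (by rw [h.apply_sum, if_neg (by simpa using hA)])

theorem exists_sum_near (h : IsMarkushevichBasis e f) (x : X) {η : ℝ} (hη : 0 < η) :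
    ∃ (H : Finset ℕ) (a : ℕ → 𝕜), ‖x - ∑ i ∈ H, a i • e i‖ < η := by
  obtain ⟨y, hy, hxy⟩ := h.dense_span.exists_dist_lt x hη
  obtain ⟨c, rfl⟩ := Finsupp.mem_span_range_iff_exists_finsupp.1 hy
  exact ⟨c.support, c, by simpa [dist_eq_norm, Finsupp.sum] using hxy⟩

/-- The coordinates of a vector tend to zero. -/
theorem finite_large_coord (h : IsMarkushevichBasis e f) (x : X) {η : ℝ} (hη : 0 < η) :
    {i | η ≤ ‖f i x‖}.Finite := by
  obtain ⟨B, hB, -, hf⟩ := h.exists_bound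
  obtain ⟨H, a, ha⟩ := h.exists_sum_near x (div_pos hη hB)
  refine H.finite_toSet.subset fun i hi => ?_
  by_contra hiH
  have h1 : f i x = f i (x - ∑ i ∈ H, a i • e i) := by
    rw [map_sub, h.apply_sum, if_neg (by simpa using hiH), sub_zero]
  have h2 : ‖f i x‖ < η := by
    rw [h1]
    calc _ ≤ B * ‖x - ∑ i ∈ H, a i • e i‖ := (f i).le_of_opNorm_le (hf i) _
      _ < B * (η / B) := by gcongr
      _ = η := by field_simp
  exact absurd h2 (not_lt.2 hi)

theorem exists_greedySet (h : IsMarkushevichBasis e f) (x : X) (m : ℕ) :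
    ∃ A : Finset ℕ, GreedySet f x m 1 A := by
  induction m with
  | zero => exact ⟨∅, by simp [GreedySet]⟩
  | succ m ih =>
    obtain ⟨A, hAm, hA⟩ := ih
    obtain ⟨k, hkA, hk⟩ : ∃ k ∉ A, ∀ l ∉ A, ‖f l x‖ ≤ ‖f k x‖ := by
      by_cases h0 : ∃ k ∉ A, f k x ≠ 0
      · obtain ⟨k, hkA, hk⟩ := h0
        have hfin := h.finite_large_coord x (norm_pos_iff.2 hk)
        obtain ⟨l, hl, hmax⟩ := Finset.exists_max_image (hfin.toFinset \ A) (fun i => ‖f i x‖)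
          ⟨k, by simp [hkA]⟩
        refine ⟨l, (Finset.mem_sdiff.1 hl).2, fun i hi => ?_⟩
        by_cases hik : ‖f k x‖ ≤ ‖f i x‖
        · exact hmax i (by simp [hi, hik])
        · exact (not_le.1 hik).le.trans (hmax k (by simp [hkA]))
      · push Not at h0
        obtain ⟨k, hk⟩ := Infinite.exists_notMem_finset A
        exact ⟨k, hk, fun l hl => by rw [h0 l hl, h0 k hk]⟩
    refine ⟨insert k A, by rw [Finset.card_insert_of_notMem hkA, hAm], fun j hj l hl => ?_⟩
    rw [Finset.mem_insert, not_or] at hl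
    rw [one_mul]
    rcases Finset.mem_insert.1 hj with rfl | hj
    · exact hk l hl.2
    · simpa using hA j hj l hl.2

end IsMarkushevichBasis

/-! ### Two applications of the almost semi-greedy property -/

section Applications

variable {e : ℕ → X} {f : ℕ → X →L[𝕜] 𝕜} {w : ℕ → ℝ} {C s : ℝ}

theorem AlmostSemiGreedy.exists_norm_add_sum_le (hasg : AlmostSemiGreedy e f w C s)
    (h : IsMarkushevichBasis e f) (hs : 0 < s) (hw : ∀ i, 0 < w i) {D E : Finset ℕ}
    (hDE : Disjoint D E) (hwDE : ∑ i ∈ D, w i ≤ ∑ i ∈ E, w i) (a : ℕ → 𝕜)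
    (ha : ∀ i ∈ D, ‖a i‖ ≤ s / 2) :
    ∃ v : ℕ → 𝕜, ‖∑ i ∈ D, a i • e i + ∑ i ∈ E, v i • e i‖ ≤
      C * ‖∑ i ∈ E, (1 : 𝕜) • e i‖ := by
  set z : X := ∑ i ∈ D, a i • e i + ∑ i ∈ E, (1 : 𝕜) • e i with hz
  have hcoord : ∀ i, f i z = (if i ∈ D then a i else 0) + if i ∈ E then 1 else 0 := fun i => by
    rw [hz, map_add, h.apply_sum, h.apply_sum]
  have hzE : ∀ i ∈ E, f i z = 1 := fun i hi => by
    rw [hcoord, if_neg (Finset.disjoint_right.1 hDE hi), if_pos hi, zero_add]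
  have hzD : ∀ i ∈ D, f i z = a i := fun i hi => by
    rw [hcoord, if_neg (Finset.disjoint_left.1 hDE hi), if_pos hi, add_zero]
  have hnE : ∀ i ∉ E, ‖f i z‖ ≤ s / 2 := fun i hi => by
    rw [hcoord, if_neg hi, add_zero]
    split_ifs with hD
    · exact ha i hD
    · rw [norm_zero]
      positivity
  obtain ⟨A, ⟨hcard, hgr⟩, y, hy, hB⟩ := hasg z E.card
  have hAE : A = E := by
    refine Finset.eq_of_subset_of_card_le (fun j hj => ?_) hcard.ge
    by_contra hjE
    obtain ⟨k, hkE, hkA⟩ : ∃ k ∈ E, k ∉ A := by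
      by_contra! hcon
      have := Finset.eq_of_subset_of_card_le (s := E) (t := A) hcon hcard.le
      exact hjE (this ▸ hj)
    have h1 := hgr j hj k hkA
    rw [hzE k hkE, norm_one, mul_one] at h1
    linarith [hnE j hjE]
  subst hAE
  refine ⟨fun i => 1 - f i y, ?_⟩
  have h1 : ∑ i ∈ D, a i • e i + ∑ i ∈ A, (1 - f i y) • e i = z - y := by
    conv_rhs => rw [h.eq_sum_of_msupp_subset hy]
    simp only [hz, sub_smul, Finset.sum_sub_distrib]
    abel
  have h2 : z - proj e f D z = ∑ i ∈ A, (1 : 𝕜) • e i := by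
    rw [proj, Finset.sum_congr rfl fun i hi => by rw [hzD i hi], hz]
    abel
  rw [h1, ← h2]
  exact hB D ((wsum_le_wsum_iff hw _ _).2 hwDE)

theorem AlmostSemiGreedy.exists_norm_sum_add_le (hasg : AlmostSemiGreedy e f w C s)
    (h : IsMarkushevichBasis e f) (hs : 0 < s) (hs1 : s ≤ 1) (hw : ∀ i, 0 < w i)
    {E G H : Finset ℕ} (hHE : Disjoint H E) (hGH : G ⊆ H)
    (hwEG : ∑ i ∈ E, w i ≤ ∑ i ∈ G, w i) (a : ℕ → 𝕜) (ha : ∀ i ∈ G, 1 ≤ ‖a i‖) :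
    ∃ t : ℕ → 𝕜, ‖∑ i ∈ H, t i • e i + ∑ i ∈ E, ((s ^ 2 / 2 : ℝ) : 𝕜) • e i‖ ≤
      C * ‖∑ i ∈ H, a i • e i‖ := by
  set δ : 𝕜 := ((s ^ 2 / 2 : ℝ) : 𝕜) with hδ
  have hδn : ‖δ‖ = s ^ 2 / 2 := by
    rw [hδ, RCLike.norm_ofReal, abs_of_pos (by positivity)]
  have hs2 : 0 < s ^ 2 := by positivity
  set z : X := ∑ i ∈ H, a i • e i + ∑ i ∈ E, δ • e i with hz
  have hcoord : ∀ i, f i z = (if i ∈ H then a i else 0) + if i ∈ E then δ else 0 := fun i => by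
    rw [hz, map_add, h.apply_sum H, h.apply_sum E fun _ => δ]
  have hzE : ∀ i ∈ E, f i z = δ := fun i hi => by
    rw [hcoord, if_neg (Finset.disjoint_right.1 hHE hi), if_pos hi, zero_add]
  have hzH : ∀ i ∈ H, f i z = a i := fun i hi => by
    rw [hcoord, if_neg (Finset.disjoint_left.1 hHE hi), if_pos hi, add_zero]
  have hnH : ∀ i ∉ H, ‖f i z‖ ≤ s ^ 2 / 2 := fun i hi => by
    rw [hcoord, if_neg hi, zero_add]
    split_ifs with hE
    · exact hδn.le
    · rw [norm_zero]
      positivity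
  set L := H.filter fun i => s ≤ ‖a i‖ with hL
  have hLs : ∀ i ∈ L, s ≤ ‖f i z‖ := fun i hi => by
    rw [hzH i (Finset.mem_filter.1 hi).1]
    exact (Finset.mem_filter.1 hi).2
  obtain ⟨A, ⟨hcard, hgr⟩, y, hy, hB⟩ := hasg z L.card
  have hAH : A ⊆ H := by
    intro j hj
    by_contra hjH
    have hLA : L ⊆ A := by
      intro k hk
      by_contra hkA
      have h1 := hgr j hj k hkA
      nlinarith [hnH j hjH, hLs k hk]
    have := Finset.eq_of_subset_of_card_le hLA hcard.le
    exact hjH ((Finset.mem_filter.1 (this ▸ hj : j ∈ L)).1)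
  have hGA : G ⊆ A := by
    intro k hk
    by_contra hkA
    have hkL : k ∈ L := Finset.mem_filter.2 ⟨hGH hk, hs1.trans (ha k hk)⟩
    have hAL : A ⊆ L := by
      intro j hj
      have h1 := hgr j hj k hkA
      rw [hzH k (hGH hk), hzH j (hAH hj)] at h1
      exact Finset.mem_filter.2 ⟨hAH hj, by nlinarith [ha k hk]⟩
    exact hkA (Finset.eq_of_subset_of_card_le hAL hcard.ge ▸ hkL)
  have hy' : msupp f y ⊆ (H : Set ℕ) := hy.trans (by exact_mod_cast hAH)
  refine ⟨fun i => a i - f i y, ?_⟩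
  have h1 : ∑ i ∈ H, (a i - f i y) • e i + ∑ i ∈ E, δ • e i = z - y := by
    conv_rhs => rw [h.eq_sum_of_msupp_subset hy']
    simp only [hz, sub_smul, Finset.sum_sub_distrib]
    abel
  have h2 : z - proj e f E z = ∑ i ∈ H, a i • e i := by
    rw [proj, Finset.sum_congr rfl fun i hi => by rw [hzE i hi], hz]
    abel
  rw [h1, ← h2]
  refine hB E ((wsum_le_wsum_iff hw _ _).2 (hwEG.trans ?_))
  exact Finset.sum_le_sum_of_subset_of_nonneg hGA fun i _ _ => (hw i).le

end Applications

/-! ### Far sets of prescribed weight -/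

theorem exists_finset_sum_crossing {w ω : ℕ → ℝ} (hω : ∀ i, 0 ≤ ω i) (hωw : ∀ i, ω i ≤ w i)
    {S : Set ℕ} (hS : ¬ Summable (S.indicator ω)) {W : ℝ} (hW : 0 < W) :
    ∃ E : Finset ℕ, (E : Set ℕ) ⊆ S ∧ W ≤ ∑ i ∈ E, w i ∧
      ∃ j ∈ E, ∑ i ∈ E.erase j, w i < W := by
  classical
  have hex : ∃ E : Finset ℕ, (E : Set ℕ) ⊆ S ∧ W ≤ ∑ i ∈ E, w i := by
    by_contra! hcon
    refine hS (summable_of_sum_le (c := W) (fun i => Set.indicator_nonneg (fun i _ => hω i) i)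
      fun u => ?_)
    have h1 := hcon (u.filter (· ∈ S)) (fun i hi => by simpa using (Finset.mem_filter.1 hi).2)
    calc ∑ i ∈ u, S.indicator ω i = ∑ i ∈ u.filter (· ∈ S), ω i := by
          rw [Finset.sum_filter]
          exact Finset.sum_congr rfl fun i _ => by rw [Set.indicator_apply]
      _ ≤ ∑ i ∈ u.filter (· ∈ S), w i := Finset.sum_le_sum fun i _ => hωw i
      _ ≤ W := h1.le
  obtain ⟨E, ⟨hES, hEW⟩, hmin⟩ := WellFounded.has_min (wellFounded_lt (α := Finset ℕ))
    {E : Finset ℕ | (E : Set ℕ) ⊆ S ∧ W ≤ ∑ i ∈ E, w i} hex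
  have hne : E.Nonempty := by
    rw [Finset.nonempty_iff_ne_empty]
    rintro rfl
    simp at hEW
    linarith
  obtain ⟨j, hj⟩ := hne
  refine ⟨E, hES, hEW, j, hj, ?_⟩
  by_contra! hcon
  exact hmin (E.erase j) ⟨fun i hi => hES (Finset.mem_of_mem_erase hi), hcon⟩
    (Finset.erase_ssubset hj)

/-- The filter of sets whose complement has finite `ω`-mass. -/
def cosummable (ω : ℕ → ℝ) : Filter ℕ where
  sets := {S | Summable (Sᶜ.indicator ω)}
  univ_sets := by
    simp
  sets_of_superset := by
    intro S T hS hST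
    have h : Tᶜ.indicator ω = Tᶜ.indicator (Sᶜ.indicator ω) := by
      rw [Set.indicator_indicator, Set.inter_eq_left.2 (Set.compl_subset_compl.2 hST)]
    rw [Set.mem_ofPred_eq, h]
    exact Summable.indicator hS _
  inter_sets := by
    intro S T hS hT
    have h : (S ∩ T)ᶜ.indicator ω = fun i => Sᶜ.indicator ω i + S.indicator (Tᶜ.indicator ω) i := by
      funext i
      by_cases h1 : i ∈ S <;> by_cases h2 : i ∈ T <;> simp [h1, h2]
    rw [Set.mem_ofPred_eq, h]
    exact Summable.add hS (Summable.indicator hT _)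

theorem mem_cosummable {ω : ℕ → ℝ} {S : Set ℕ} :
    S ∈ cosummable ω ↔ Summable (Sᶜ.indicator ω) := Iff.rfl

theorem cosummable_neBot {ω : ℕ → ℝ} (hω : ¬ Summable ω) : (cosummable ω).NeBot := by
  rw [neBot_iff, Ne, ← empty_mem_iff_bot, mem_cosummable]
  simpa using hω

theorem compl_finset_mem_cosummable (ω : ℕ → ℝ) (H : Finset ℕ) :
    ((H : Set ℕ)ᶜ) ∈ cosummable ω := by
  rw [mem_cosummable, compl_compl]
  refine summable_of_ne_finset_zero (s := H) fun i hi => ?_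
  simp [hi]

theorem exists_ultrafilter_not_summable {ω : ℕ → ℝ} (hω : ¬ Summable ω) :
    ∃ U : Ultrafilter ℕ, (∀ S ∈ U, ¬ Summable (S.indicator ω)) ∧
      ∀ H : Finset ℕ, ((H : Set ℕ)ᶜ) ∈ U := by
  have := cosummable_neBot hω
  refine ⟨Ultrafilter.of (cosummable ω), fun S hS hsum => ?_, fun H =>
    Ultrafilter.of_le _ (compl_finset_mem_cosummable ω H)⟩
  have h1 : Sᶜ ∈ cosummable ω := by rwa [mem_cosummable, compl_compl]
  exact Ultrafilter.compl_notMem_iff.2 hS (Ultrafilter.of_le _ h1)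

/-! ### Weak limits in the bidual -/

theorem exists_bidual_limit {e : ℕ → X} {ω : ℕ → ℝ} (U : Ultrafilter ℕ) {R : ℝ}
    (hω : ∀ i, 0 < ω i)
    (hR : ∀ g : X →L[𝕜] 𝕜, {i | ‖g (e i)‖ ≤ R * ‖g‖ * ω i} ∈ U) :
    ∃ Λ : (X →L[𝕜] 𝕜) →L[𝕜] 𝕜, ∀ g : X →L[𝕜] 𝕜,
      Tendsto (fun i => (ω i : 𝕜)⁻¹ * g (e i)) U (nhds (Λ g)) := by
  have hlim : ∀ g : X →L[𝕜] 𝕜, ∃ l : 𝕜, ‖l‖ ≤ R * ‖g‖ ∧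
      Tendsto (fun i => (ω i : 𝕜)⁻¹ * g (e i)) U (nhds l) := by
    intro g
    have hmem : (U.map fun i => (ω i : 𝕜)⁻¹ * g (e i) : Filter 𝕜) ≤
        𝓟 (Metric.closedBall 0 (R * ‖g‖)) := by
      rw [le_principal_iff]
      refine mem_map.2 (mem_of_superset (hR g) fun i hi => ?_)
      have h1 : ‖g (e i)‖ ≤ R * ‖g‖ * ω i := hi
      rw [Set.mem_preimage, mem_closedBall_zero_iff, norm_mul, norm_inv, RCLike.norm_ofReal,
        abs_of_pos (hω i), inv_mul_le_iff₀ (hω i)]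
      linarith
    obtain ⟨l, hl, hle⟩ := (isCompact_closedBall (0 : 𝕜) (R * ‖g‖)).ultrafilter_le_nhds
      (U.map fun i => (ω i : 𝕜)⁻¹ * g (e i)) hmem
    exact ⟨l, by simpa using hl, hle⟩
  choose l hl hlt using hlim
  refine ⟨LinearMap.mkContinuous
    { toFun := l
      map_add' := fun g g' => tendsto_nhds_unique (hlt (g + g')) (by
        simpa [mul_add] using (hlt g).add (hlt g'))
      map_smul' := fun c g => tendsto_nhds_unique (hlt (c • g)) (by
        simpa [mul_left_comm] using (hlt g).const_mul c) } R hl, hlt⟩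

theorem exists_norm_le_norm_add_smul [CompleteSpace X] {Z : Type*} [NormedAddCommGroup Z]
    [NormedSpace 𝕜 Z] (J : X →ₗᵢ[𝕜] Z) (z : Z) (hz : ∀ x, J x = z → x = 0) :
    ∃ M : ℝ, 0 < M ∧ ∀ (x : X) (c : 𝕜), ‖x‖ ≤ M * ‖J x + c • z‖ := by
  have hclosed : IsClosed (Set.range J) := J.isometry.isClosedEmbedding.isClosed_range
  by_cases hmem : z ∈ Set.range J
  · obtain ⟨x₀, rfl⟩ := hmem
    exact ⟨1, one_pos, fun x c => by simp [hz x₀ rfl]⟩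
  · have hd : 0 < Metric.infDist z (Set.range J) :=
      (hclosed.notMem_iff_infDist_pos ⟨_, 0, rfl⟩).1 hmem
    set d := Metric.infDist z (Set.range J)
    have hc : ∀ (x : X) (c : 𝕜), ‖c‖ * d ≤ ‖J x + c • z‖ := by
      intro x c
      by_cases hc0 : c = 0
      · simp [hc0]
      have h1 : d ≤ dist z (J (-c⁻¹ • x)) := Metric.infDist_le_dist_of_mem ⟨_, rfl⟩
      have h2 : J x + c • z = c • (z - J (-c⁻¹ • x)) := by
        rw [map_smul, smul_sub, smul_smul, mul_neg, mul_inv_cancel₀ hc0]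
        simp [add_comm]
      rw [h2, norm_smul, ← dist_eq_norm]
      gcongr
    refine ⟨1 + ‖z‖ / d, by positivity, fun x c => ?_⟩
    calc ‖x‖ = ‖(J x + c • z) - c • z‖ := by rw [add_sub_cancel_right, J.norm_map]
      _ ≤ ‖J x + c • z‖ + ‖c‖ * ‖z‖ := by
          rw [← norm_smul]
          exact norm_sub_le _ _
      _ = ‖J x + c • z‖ + ‖z‖ / d * (‖c‖ * d) := by
          field_simp
      _ ≤ ‖J x + c • z‖ + ‖z‖ / d * ‖J x + c • z‖ := by
          gcongr
          exact hc x c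
      _ = (1 + ‖z‖ / d) * ‖J x + c • z‖ := by ring

theorem isCompact_image_sum_add_smul {Z : Type*} [NormedAddCommGroup Z] [NormedSpace 𝕜 Z]
    (J : X →ₗᵢ[𝕜] Z) (z : Z) (e : ℕ → X) (H : Finset ℕ) (r : ℝ) :
    IsCompact ((fun p : (ℕ → 𝕜) × 𝕜 => J (∑ i ∈ H, p.1 i • e i) + p.2 • z) ''
      ((Set.univ.pi fun _ => Metric.closedBall 0 1) ×ˢ Metric.closedBall 0 r)) := by
  refine IsCompact.image ((isCompact_univ_pi fun _ => isCompact_closedBall _ _).prod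
    (isCompact_closedBall _ _)) ?_
  have h1 : Continuous fun p : (ℕ → 𝕜) × 𝕜 => ∑ i ∈ H, p.1 i • e i := by fun_prop
  exact (J.continuous.comp h1).add (continuous_snd.smul continuous_const)

theorem exists_finite_norming {Y : Type*} [NormedAddCommGroup Y] [NormedSpace 𝕜 Y]
    {Q : Set (Y →L[𝕜] 𝕜)} (hQ : IsCompact Q) {ε : ℝ} (hε : 0 < ε) :
    ∃ T : Finset Y, (∀ g ∈ T, ‖g‖ ≤ 1) ∧ ∀ κ ∈ Q, ∃ g ∈ T, ‖κ‖ < ‖κ g‖ + ε := by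
  classical
  have hpick : ∀ κ : Y →L[𝕜] 𝕜, ∃ g : Y, ‖g‖ ≤ 1 ∧ ‖κ‖ < ‖κ g‖ + ε := by
    intro κ
    obtain ⟨g, hg, hlt⟩ := κ.exists_lt_apply_of_lt_opNorm (sub_lt_self ‖κ‖ hε)
    exact ⟨g, hg.le, by linarith⟩
  choose g hg hlt using hpick
  obtain ⟨t, -, ht⟩ := hQ.elim_nhds_subcover
    (fun κ => {κ' : Y →L[𝕜] 𝕜 | ‖κ'‖ < ‖κ' (g κ)‖ + ε}) fun κ _ => by
      refine IsOpen.mem_nhds (isOpen_lt continuous_norm ?_) (hlt κ)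
      fun_prop
  refine ⟨t.image g, fun y hy => ?_, fun κ hκ => ?_⟩
  · obtain ⟨κ, -, rfl⟩ := Finset.mem_image.1 hy
    exact hg κ
  · obtain ⟨κ', hκ', hmem⟩ := Set.mem_iUnion₂.1 (ht hκ)
    exact ⟨g κ', Finset.mem_image_of_mem g hκ', hmem⟩

/-! ### Separation from far sets -/

theorem sum_norm_apply_le {e : ℕ → X} {K : ℝ} {D : Finset ℕ}
    (hD : ∀ a : ℕ → 𝕜, (∀ i ∈ D, ‖a i‖ ≤ 1) → ‖∑ i ∈ D, a i • e i‖ ≤ K) (g : X →L[𝕜] 𝕜) :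
    ∑ i ∈ D, ‖g (e i)‖ ≤ K * ‖g‖ := by
  have hsgn : ∀ z : 𝕜, ∃ a : 𝕜, ‖a‖ ≤ 1 ∧ a * z = (‖z‖ : 𝕜) := by
    intro z
    by_cases hz : z = 0
    · exact ⟨0, by simp [hz]⟩
    · exact ⟨(‖z‖ : 𝕜) / z, by simp [hz], by field_simp⟩
  choose σ hσ hσz using hsgn
  have h1 := hD (fun i => σ (g (e i))) fun i _ => hσ _
  have h2 : g (∑ i ∈ D, σ (g (e i)) • e i) = ((∑ i ∈ D, ‖g (e i)‖ : ℝ) : 𝕜) := by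
    simp [map_sum, hσz]
  have h3 : ∑ i ∈ D, ‖g (e i)‖ = ‖g (∑ i ∈ D, σ (g (e i)) • e i)‖ := by
    rw [h2, RCLike.norm_ofReal, abs_of_nonneg (Finset.sum_nonneg fun i _ => norm_nonneg _)]
  rw [h3, mul_comm]
  exact (g.le_opNorm _).trans (by gcongr)

theorem exists_apply_le_mem_ultrafilter {e : ℕ → X} {w : ℕ → ℝ} {B K : ℝ}
    (hB : ∀ i, ‖e i‖ ≤ B) (hw : ∀ i, 0 < w i)
    (hK : ∀ D : Finset ℕ, 0 ∉ D → ∑ i ∈ D, w i ≤ w 0 → ∀ a : ℕ → 𝕜, (∀ i ∈ D, ‖a i‖ ≤ 1) →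
      ‖∑ i ∈ D, a i • e i‖ ≤ K)
    (U : Ultrafilter ℕ) (hU : ∀ S ∈ U, ¬ Summable (S.indicator fun i => min (w i) 1))
    (hU' : ∀ H : Finset ℕ, ((H : Set ℕ)ᶜ) ∈ U) :
    ∃ R : ℝ, ∀ g : X →L[𝕜] 𝕜, {i | ‖g (e i)‖ ≤ R * ‖g‖ * min (w i) 1} ∈ U := by
  have hB0 : 0 ≤ B := (norm_nonneg _).trans (hB 0)
  have hK0 : 0 ≤ K := by simpa using hK ∅ (by simp) (by simpa using (hw 0).le) 0 (by simp)
  obtain ⟨α, hα, hα2, hα1⟩ : ∃ α : ℝ, 0 < α ∧ 2 * α ≤ w 0 ∧ α ≤ 1 :=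
    ⟨min (w 0 / 2) 1, lt_min (half_pos (hw 0)) one_pos,
      by linarith [min_le_left (w 0 / 2) 1], min_le_right _ _⟩
  refine ⟨(B + K) / α, fun g => ?_⟩
  by_contra hcon
  set P : Set ℕ := {i | ‖g (e i)‖ ≤ (B + K) / α * ‖g‖ * min (w i) 1}ᶜ ∩
    (({0} : Finset ℕ) : Set ℕ)ᶜ with hP
  have hPU : P ∈ U := inter_mem (Ultrafilter.compl_mem_iff_notMem.2 hcon) (hU' {0})
  have hPi : ∀ i ∈ P, (B + K) / α * ‖g‖ * min (w i) 1 < ‖g (e i)‖ := fun i hi => not_le.1 hi.1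
  have hPα : ∀ i ∈ P, w i < α := by
    intro i hi
    by_contra! hle
    have h1 := hPi i hi
    have h2 : ‖g (e i)‖ ≤ ‖g‖ * B := (g.le_opNorm _).trans (by gcongr; exact hB i)
    have h3 : (B + K) / α * ‖g‖ * α ≤ (B + K) / α * ‖g‖ * min (w i) 1 := by
      gcongr
      exact le_min hle hα1
    have h4 : (B + K) / α * ‖g‖ * α = (B + K) * ‖g‖ := by field_simp
    nlinarith [mul_nonneg hK0 (norm_nonneg g)]
  obtain ⟨E, hEP, hEW, j, hj, hEj⟩ := exists_finset_sum_crossing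
    (w := w) (fun i => (lt_min (hw i) one_pos).le) (fun i => min_le_left _ _) (hU P hPU) hα
  have hwE : ∑ i ∈ E, w i ≤ w 0 := by
    rw [← Finset.sum_erase_add E w hj]
    linarith [hPα j (hEP hj)]
  have h0E : 0 ∉ E := fun h0 => (hEP h0).2 (by simp)
  have h1 := sum_norm_apply_le (hK E h0E hwE) g
  have h2 : (B + K) / α * ‖g‖ * ∑ i ∈ E, w i < ∑ i ∈ E, ‖g (e i)‖ := by
    rw [Finset.mul_sum]
    refine Finset.sum_lt_sum_of_nonempty ⟨j, hj⟩ fun i hi => ?_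
    have h3 := hPi i (hEP hi)
    rwa [min_eq_left ((hPα i (hEP hi)).le.trans hα1)] at h3
  have h3 : (B + K) / α * ‖g‖ * α ≤ (B + K) / α * ‖g‖ * ∑ i ∈ E, w i := by gcongr
  have h4 : (B + K) / α * ‖g‖ * α = (B + K) * ‖g‖ := by field_simp
  nlinarith [mul_nonneg hB0 (norm_nonneg g)]

theorem not_summable_min_one {w : ℕ → ℝ} (hsum : ¬ Summable w) :
    ¬ Summable fun i => min (w i) 1 := by
  intro h
  refine hsum (h.congr_cofinite ?_)
  filter_upwards [h.tendsto_cofinite_zero.eventually_lt_const one_pos] with i hi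
  rcases min_lt_iff.1 hi with h1 | h1
  · exact min_eq_left h1.le
  · exact absurd h1 (lt_irrefl _)

theorem IsMarkushevichBasis.exists_separated_sets [CompleteSpace X] {e : ℕ → X}
    {f : ℕ → X →L[𝕜] 𝕜} {w : ℕ → ℝ} {K : ℝ} (h : IsMarkushevichBasis e f) (hw : ∀ i, 0 < w i)
    (hsum : ¬ Summable w)
    (hK : ∀ D : Finset ℕ, 0 ∉ D → ∑ i ∈ D, w i ≤ w 0 → ∀ a : ℕ → 𝕜, (∀ i ∈ D, ‖a i‖ ≤ 1) →
      ‖∑ i ∈ D, a i • e i‖ ≤ K) :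
    ∃ M : ℝ, 0 < M ∧ ∀ (H : Finset ℕ) (W : ℝ), 0 < W → ∃ E : Finset ℕ, Disjoint H E ∧
      W ≤ ∑ i ∈ E, w i ∧ (∃ j ∈ E, ∑ i ∈ E.erase j, w i < W) ∧
      ∀ t v : ℕ → 𝕜, ‖∑ i ∈ H, t i • e i‖ ≤
        M * ‖∑ i ∈ H, t i • e i + ∑ i ∈ E, v i • e i‖ := by
  classical
  obtain ⟨B, hB, hBe, hBf⟩ := h.exists_bound
  obtain ⟨U, hU, hU'⟩ := exists_ultrafilter_not_summable (not_summable_min_one hsum)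
  set ω : ℕ → ℝ := fun i => min (w i) 1 with hω
  have hω0 : ∀ i, 0 < ω i := fun i => lt_min (hw i) one_pos
  obtain ⟨R, hR⟩ := exists_apply_le_mem_ultrafilter hBe hw hK U hU hU'
  obtain ⟨Λ, hΛ⟩ := exists_bidual_limit U hω0 hR
  have hΛf : ∀ i, Λ (f i) = 0 := by
    intro i
    refine tendsto_nhds_unique (hΛ (f i)) (tendsto_const_nhds.congr' ?_)
    filter_upwards [hU' {i}] with k hk
    have : i ≠ k := fun hik => hk (by simp [hik])
    simp [h.biorth, this]
  set J := NormedSpace.inclusionInDoubleDualLi 𝕜 (E := X)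
  have hJΛ : ∀ x, J x = Λ → x = 0 := fun x hx =>
    h.total x fun i => by rw [← hΛf i, ← hx]; rfl
  obtain ⟨M, hM, hMx⟩ := exists_norm_le_norm_add_smul (𝕜 := 𝕜) (X := X)
    (Z := StrongDual 𝕜 (StrongDual 𝕜 X)) J Λ hJΛ
  refine ⟨M * (1 + 2 * B), by positivity, fun H W hW => ?_⟩
  obtain ⟨T, hT1, hT⟩ := exists_finite_norming
    (isCompact_image_sum_add_smul (𝕜 := 𝕜) J Λ e H (W + 1)) one_pos
  set ε : ℝ := 1 / (W + 1) with hε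
  have hε0 : 0 < ε := by positivity
  set S : Set ℕ := {i | ∀ g ∈ T, ‖(ω i : 𝕜)⁻¹ * g (e i) - Λ g‖ < ε} ∩ (H : Set ℕ)ᶜ
  have hSU : S ∈ U := by
    refine inter_mem ?_ (hU' H)
    refine (Filter.eventually_all_finset T).2 fun g _ => ?_
    have := (hΛ g).eventually (Metric.ball_mem_nhds _ hε0)
    filter_upwards [this] with i hi
    simpa [dist_eq_norm] using hi
  obtain ⟨E, hES, hEW, j, hj, hEj⟩ := exists_finset_sum_crossing
    (w := w) (fun i => (hω0 i).le) (fun i => min_le_left _ _) (hU S hSU) hW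
  have hHE : Disjoint H E :=
    Finset.disjoint_right.2 fun i hi hiH => (hES hi).2 hiH
  have hωE : ∑ i ∈ E, ω i ≤ W + 1 := by
    rw [← Finset.sum_erase_add E ω hj]
    have h1 : ∑ i ∈ E.erase j, ω i ≤ ∑ i ∈ E.erase j, w i :=
      Finset.sum_le_sum fun i _ => min_le_left _ _
    have h2 : ω j ≤ 1 := min_le_right _ _
    linarith
  refine ⟨E, hHE, hEW, ⟨j, hj, hEj⟩, ?_⟩
  have hnormalized : ∀ t v : ℕ → 𝕜, (∀ i, ‖t i‖ ≤ 1) → (∀ i, ‖v i‖ ≤ 1) →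
      ‖∑ i ∈ H, t i • e i‖ ≤ M * (‖∑ i ∈ H, t i • e i + ∑ i ∈ E, v i • e i‖ + 2) := by
    intro t v ht hv
    set c : 𝕜 := ∑ i ∈ E, v i * (ω i : 𝕜) with hc
    have hterm : ∀ i, ‖v i * (ω i : 𝕜)‖ ≤ ω i := fun i => by
      rw [norm_mul, RCLike.norm_ofReal, abs_of_pos (hω0 i)]
      exact mul_le_of_le_one_left (hω0 i).le (hv i)
    have hcW : ‖c‖ ≤ W + 1 :=
      (norm_sum_le_of_le _ fun i _ => hterm i).trans hωE
    obtain ⟨g, hgT, hg⟩ := hT (J (∑ i ∈ H, t i • e i) + c • Λ)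
      ⟨(t, c), ⟨fun i _ => by simpa using ht i, by simpa using hcW⟩, rfl⟩
    have hdiff : (J (∑ i ∈ H, t i • e i) + c • Λ) g =
        g (∑ i ∈ H, t i • e i + ∑ i ∈ E, v i • e i) -
          ∑ i ∈ E, (v i * (ω i : 𝕜)) * ((ω i : 𝕜)⁻¹ * g (e i) - Λ g) := by
      have h1 : ∀ i, (v i * (ω i : 𝕜)) * ((ω i : 𝕜)⁻¹ * g (e i) - Λ g) =
          v i * g (e i) - v i * (ω i : 𝕜) * Λ g := fun i => by
        have : (ω i : 𝕜) ≠ 0 := by exact_mod_cast (hω0 i).ne'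
        field_simp
      have h2 : (J (∑ i ∈ H, t i • e i)) g = g (∑ i ∈ H, t i • e i) := rfl
      simp only [h1, Finset.sum_sub_distrib, ← Finset.sum_mul, ← hc]
      have h3 : g (∑ i ∈ E, v i • e i) = ∑ i ∈ E, v i * g (e i) := by simp [map_sum]
      rw [add_apply, h2, smul_apply, smul_eq_mul, map_add, h3]
      ring
    have herr : ‖∑ i ∈ E, (v i * (ω i : 𝕜)) * ((ω i : 𝕜)⁻¹ * g (e i) - Λ g)‖ ≤ 1 := by
      calc _ ≤ ∑ i ∈ E, ω i * ε := by
            refine norm_sum_le_of_le _ fun i hi => ?_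
            rw [norm_mul]
            exact mul_le_mul (hterm i) ((hES hi).1 g hgT).le (norm_nonneg _) (hω0 i).le
        _ = (∑ i ∈ E, ω i) * ε := by rw [Finset.sum_mul]
        _ ≤ (W + 1) * ε := by gcongr
        _ = 1 := by rw [hε]; field_simp
    have hgle : ‖g (∑ i ∈ H, t i • e i + ∑ i ∈ E, v i • e i)‖ ≤
        ‖∑ i ∈ H, t i • e i + ∑ i ∈ E, v i • e i‖ :=
      (g.le_of_opNorm_le (hT1 g hgT) _).trans (by rw [one_mul])
    refine (hMx _ c).trans (mul_le_mul_of_nonneg_left ?_ hM.le)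
    have h5 := norm_sub_le (g (∑ i ∈ H, t i • e i + ∑ i ∈ E, v i • e i))
      (∑ i ∈ E, (v i * (ω i : 𝕜)) * ((ω i : 𝕜)⁻¹ * g (e i) - Λ g))
    rw [← hdiff] at h5
    linarith
  intro t v
  set p : X := ∑ i ∈ H, t i • e i + ∑ i ∈ E, v i • e i with hp
  have hcoord : ∀ i, f i p = (if i ∈ H then t i else 0) + if i ∈ E then v i else 0 := fun i => by
    rw [hp, map_add, h.apply_sum, h.apply_sum]
  have hpH : ∑ i ∈ H, t i • e i = ∑ i ∈ H, f i p • e i := Finset.sum_congr rfl fun i hi => by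
    rw [hcoord, if_pos hi, if_neg (Finset.disjoint_left.1 hHE hi), add_zero]
  have hpE : ∑ i ∈ E, v i • e i = ∑ i ∈ E, f i p • e i := Finset.sum_congr rfl fun i hi => by
    rw [hcoord, if_pos hi, if_neg (Finset.disjoint_right.1 hHE hi), zero_add]
  by_cases hp0 : p = 0
  · simp [hpH, hp0]
  have hN : 0 < B * ‖p‖ := mul_pos hB (norm_pos_iff.2 hp0)
  set r : 𝕜 := ((B * ‖p‖ : ℝ) : 𝕜)⁻¹ with hr
  have hrn : ‖r‖ = (B * ‖p‖)⁻¹ := by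
    rw [hr, norm_inv, RCLike.norm_ofReal, abs_of_pos hN]
  have hcoef : ∀ i, ‖r * f i p‖ ≤ 1 := fun i => by
    rw [norm_mul, hrn, inv_mul_le_iff₀ hN, mul_one]
    exact (f i).le_of_opNorm_le (hBf i) p
  have hfin := hnormalized (fun i => r * f i p) (fun i => r * f i p) hcoef hcoef
  simp only [mul_smul, ← Finset.smul_sum] at hfin
  rw [← hpH, ← hpE, ← smul_add, ← hp, norm_smul, norm_smul, hrn, inv_mul_le_iff₀ hN] at hfin
  refine hfin.trans (le_of_eq ?_)
  field_simp

/-! ### Domination by large coordinates -/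

/-- Sums over `D` with coefficients at most `c` are dominated by every vector whose coordinates
are at least `c` on a set of `w`-measure at least that of `D`. -/
def LargeCoordDomination (e : ℕ → X) (f : ℕ → X →L[𝕜] 𝕜) (w : ℕ → ℝ) (K : ℝ) : Prop :=
  ∀ (x : X) (D G : Finset ℕ) (a : ℕ → 𝕜) (c : ℝ), 0 < c → (∀ i ∈ G, c ≤ ‖f i x‖) →
    (∀ i ∈ D, ‖a i‖ ≤ c) → ∑ i ∈ D, w i ≤ ∑ i ∈ G, w i → ‖∑ i ∈ D, a i • e i‖ ≤ K * ‖x‖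

section Domination

variable {e : ℕ → X} {f : ℕ → X →L[𝕜] 𝕜} {w : ℕ → ℝ}

theorem le_mul_norm_of_le_apply {B : ℝ} (hBf : ∀ i, ‖f i‖ ≤ B) {x : X} {i : ℕ} {c : ℝ}
    (hx : c ≤ ‖f i x‖) : c ≤ B * ‖x‖ :=
  hx.trans ((f i).le_of_opNorm_le (hBf i) x)

theorem nonempty_of_sum_le {D G : Finset ℕ} (hw : ∀ i, 0 < w i)
    (hD : D.Nonempty) (hDG : ∑ i ∈ D, w i ≤ ∑ i ∈ G, w i) : G.Nonempty := by
  rw [Finset.nonempty_iff_ne_empty]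
  rintro rfl
  have := Finset.sum_pos (fun i _ => hw i) hD
  simp at hDG
  linarith

/-- It suffices to check domination on finitely supported vectors and for `c = 1`. -/
theorem IsMarkushevichBasis.largeCoordDomination_of_finite (h : IsMarkushevichBasis e f)
    (hw : ∀ i, 0 < w i) {K : ℝ} (hK0 : 0 ≤ K)
    (hK : ∀ (H D G : Finset ℕ) (a b : ℕ → 𝕜), D.Nonempty → D ⊆ H → G ⊆ H →
      (∀ i ∈ G, 1 ≤ ‖b i‖) → (∀ i ∈ D, ‖a i‖ ≤ 1) → ∑ i ∈ D, w i ≤ ∑ i ∈ G, w i →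
      ‖∑ i ∈ D, a i • e i‖ ≤ K * ‖∑ i ∈ H, b i • e i‖) :
    LargeCoordDomination e f w (4 * K) := by
  classical
  intro x D G a c hc hG hD hDG
  rcases D.eq_empty_or_nonempty with rfl | hDne
  · simp only [Finset.sum_empty, norm_zero]
    positivity
  obtain ⟨B, hB, -, hBf⟩ := h.exists_bound
  obtain ⟨k, hk⟩ := nonempty_of_sum_le hw hDne hDG
  have hx : c ≤ B * ‖x‖ := le_mul_norm_of_le_apply hBf (hG k hk)
  obtain ⟨H, b, hb⟩ := h.exists_sum_near x (η := c / (2 * B)) (by positivity)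
  set u : X := ∑ i ∈ H, b i • e i with hu
  have hux : ‖u‖ ≤ 2 * ‖x‖ := by
    have h1 : c / (2 * B) ≤ ‖x‖ := by
      rw [div_le_iff₀ (by positivity)]
      nlinarith [norm_nonneg x]
    have h2 := norm_sub_norm_le u x
    rw [norm_sub_rev] at h2
    linarith
  have hGu : ∀ i ∈ G, c / 2 ≤ ‖f i u‖ := by
    intro i hi
    have h1 : ‖f i (x - u)‖ ≤ c / 2 := by
      calc _ ≤ B * ‖x - u‖ := (f i).le_of_opNorm_le (hBf i) _
        _ ≤ B * (c / (2 * B)) := by gcongr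
        _ = c / 2 := by field_simp
    rw [map_sub] at h1
    have h2 := norm_sub_norm_le (f i x) (f i u)
    linarith [hG i hi]
  have hGH : G ⊆ H := by
    intro i hi
    by_contra hiH
    have h1 := hGu i hi
    rw [hu, h.apply_sum, if_neg hiH, norm_zero] at h1
    linarith
  have hsum : ∑ i ∈ H ∪ D, f i u • e i = u := by
    refine (h.eq_sum_of_msupp_subset ((h.msupp_sum_subset H b).trans ?_)).symm
    exact_mod_cast Finset.subset_union_left
  have hcn : ‖((c : ℝ) : 𝕜)⁻¹‖ = c⁻¹ := by rw [norm_inv, RCLike.norm_ofReal, abs_of_pos hc]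
  have h2 : ‖(2 : 𝕜)‖ = 2 := RCLike.norm_two
  have hmain := hK (H ∪ D) D G (fun i => ((c : ℝ) : 𝕜)⁻¹ * a i)
    (fun i => (((c : ℝ) : 𝕜)⁻¹ * 2) * f i u) hDne Finset.subset_union_right
    (hGH.trans Finset.subset_union_left) (fun i hi => ?_) (fun i hi => ?_) hDG
  · simp only [mul_smul _ (a _), mul_smul _ (f _ u), ← Finset.smul_sum, hsum] at hmain
    rw [norm_smul, norm_smul, norm_mul, hcn, h2] at hmain
    have h3 : c⁻¹ * ‖∑ i ∈ D, a i • e i‖ ≤ c⁻¹ * (4 * K * ‖x‖) := by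
      refine hmain.trans ?_
      calc K * (c⁻¹ * 2 * ‖u‖) ≤ K * (c⁻¹ * 2 * (2 * ‖x‖)) := by gcongr
        _ = c⁻¹ * (4 * K * ‖x‖) := by ring
    exact le_of_mul_le_mul_left h3 (inv_pos.2 hc)
  · rw [norm_mul, norm_mul, hcn, h2]
    calc (1 : ℝ) = c⁻¹ * 2 * (c / 2) := by field_simp
      _ ≤ _ := by gcongr; exact hGu i hi
  · rw [norm_mul, hcn, inv_mul_le_iff₀ hc, mul_one]
    exact hD i hi

theorem AlmostSemiGreedy.exists_norm_sum_le_of_sum_le {C s : ℝ}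
    (hasg : AlmostSemiGreedy e f w C s) (h : IsMarkushevichBasis e f) (hC : 0 < C) (hs : 0 < s)
    (hw : ∀ i, 0 < w i) :
    ∃ K : ℝ, 0 ≤ K ∧ ∀ D : Finset ℕ, 0 ∉ D → ∑ i ∈ D, w i ≤ w 0 → ∀ a : ℕ → 𝕜,
      (∀ i ∈ D, ‖a i‖ ≤ 1) → ‖∑ i ∈ D, a i • e i‖ ≤ K := by
  obtain ⟨B, hB, hBe, hBf⟩ := h.exists_bound
  refine ⟨(2 / s) * (C * B + B * (C * B) * B), by positivity, fun D h0 hD a ha => ?_⟩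
  have hs2 : ‖((s / 2 : ℝ) : 𝕜)‖ = s / 2 := by
    rw [RCLike.norm_ofReal, abs_of_pos (by positivity)]
  obtain ⟨v, hv⟩ := hasg.exists_norm_add_sum_le h hs hw (D := D) (E := {0}) (by simpa using h0)
    (by simpa using hD) (fun i => ((s / 2 : ℝ) : 𝕜) * a i) fun i hi => by
      rw [norm_mul, hs2]
      exact mul_le_of_le_one_right (by positivity) (ha i hi)
  simp only [mul_smul, ← Finset.smul_sum, Finset.sum_singleton, one_smul] at hv
  set y : X := ∑ i ∈ D, a i • e i with hy
  set p : X := ((s / 2 : ℝ) : 𝕜) • y + v 0 • e 0 with hp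
  have hpC : ‖p‖ ≤ C * B := hv.trans (by gcongr; exact hBe 0)
  have hv0 : f 0 p = v 0 := by
    rw [hp, map_add, map_smul, map_smul, hy, h.apply_sum, if_neg h0, h.biorth]
    simp
  have hvB : ‖v 0 • e 0‖ ≤ B * (C * B) * B := by
    rw [norm_smul]
    refine mul_le_mul ?_ (hBe 0) (norm_nonneg _) (by positivity)
    rw [← hv0]
    exact ((f 0).le_of_opNorm_le (hBf 0) p).trans (by gcongr)
  have h1 : (s / 2) * ‖y‖ ≤ C * B + B * (C * B) * B := by
    calc (s / 2) * ‖y‖ = ‖p - v 0 • e 0‖ := by rw [hp, add_sub_cancel_right, norm_smul, hs2]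
      _ ≤ ‖p‖ + ‖v 0 • e 0‖ := norm_sub_le _ _
      _ ≤ _ := add_le_add hpC hvB
  calc ‖y‖ = (2 / s) * ((s / 2) * ‖y‖) := by field_simp
    _ ≤ _ := by gcongr

/-- For summable weights all sums with coefficients at most one are uniformly bounded. -/
theorem exists_norm_sum_le_of_summable {B K : ℝ} (hB : 0 ≤ B) (hK0 : 0 ≤ K)
    (hBe : ∀ i, ‖e i‖ ≤ B) (hw : ∀ i, 0 < w i) (hsum : Summable w)
    (hK : ∀ D : Finset ℕ, 0 ∉ D → ∑ i ∈ D, w i ≤ w 0 → ∀ a : ℕ → 𝕜, (∀ i ∈ D, ‖a i‖ ≤ 1) →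
      ‖∑ i ∈ D, a i • e i‖ ≤ K) :
    ∃ L : ℝ, 0 ≤ L ∧ ∀ (D : Finset ℕ) (a : ℕ → 𝕜), (∀ i ∈ D, ‖a i‖ ≤ 1) →
      ‖∑ i ∈ D, a i • e i‖ ≤ L := by
  classical
  obtain ⟨T, hT⟩ := summable_iff_vanishing_norm.1 hsum (w 0) (hw 0)
  set T' := insert 0 T
  refine ⟨T'.card * (1 * B) + K, by positivity, fun D a ha => ?_⟩
  rw [← Finset.sum_inter_add_sum_sdiff D T']
  refine (norm_add_le _ _).trans (add_le_add ?_ ?_)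
  · refine (norm_sum_smul_le hBe zero_le_one _ a fun i hi =>
      ha i (Finset.mem_inter.1 hi).1).trans ?_
    gcongr
    exact Finset.inter_subset_right
  · refine hK _ (by simp [T']) ?_ a fun i hi => ha i (Finset.mem_sdiff.1 hi).1
    refine (le_abs_self _).trans (hT _ ?_).le
    refine Finset.disjoint_left.2 fun i hi hiT => (Finset.mem_sdiff.1 hi).2 ?_
    exact Finset.mem_insert_of_mem hiT

theorem AlmostSemiGreedy.exists_largeCoordDomination [CompleteSpace X] {C s : ℝ}
    (hasg : AlmostSemiGreedy e f w C s) (h : IsMarkushevichBasis e f) (hC : 0 < C)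
    (hs : 0 < s) (hs1 : s ≤ 1) (hw : ∀ i, 0 < w i) :
    ∃ K : ℝ, 0 ≤ K ∧ LargeCoordDomination e f w K := by
  obtain ⟨B, hB, hBe, hBf⟩ := h.exists_bound
  obtain ⟨K, hK0, hK⟩ := hasg.exists_norm_sum_le_of_sum_le h hC hs hw
  have hxB : ∀ (H G D : Finset ℕ) (b : ℕ → 𝕜), D.Nonempty → G ⊆ H → (∀ i ∈ G, 1 ≤ ‖b i‖) →
      ∑ i ∈ D, w i ≤ ∑ i ∈ G, w i → 1 ≤ B * ‖∑ i ∈ H, b i • e i‖ := by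
    intro H G D b hD hGH hb hDG
    obtain ⟨k, hk⟩ := nonempty_of_sum_le hw hD hDG
    refine le_mul_norm_of_le_apply hBf (i := k) ?_
    rw [h.apply_sum, if_pos (hGH hk)]
    exact hb k hk
  by_cases hsum : Summable w
  · obtain ⟨L, hL0, hL⟩ := exists_norm_sum_le_of_summable hB.le hK0 hBe hw hsum hK
    refine ⟨4 * (L * B), by positivity, h.largeCoordDomination_of_finite hw (by positivity) ?_⟩
    intro H D G a b hD _ hGH hb ha hDG
    have h1 := hxB H G D b hD hGH hb hDG
    calc _ ≤ L * 1 := by rw [mul_one]; exact hL D a ha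
      _ ≤ L * (B * ‖∑ i ∈ H, b i • e i‖) := by gcongr
      _ = _ := by ring
  · obtain ⟨M, hM, hsep⟩ := h.exists_separated_sets hw hsum hK
    set δ : ℝ := s ^ 2 / 2 with hδ
    have hδ0 : 0 < δ := by positivity
    set L : ℝ := 2 / s * (M * (C * ((1 + M) * C / δ + B * B))) with hL
    refine ⟨4 * L, by positivity, h.largeCoordDomination_of_finite hw (by positivity) ?_⟩
    intro H D G a b hD hDH hGH hb ha hDG
    have h1 := hxB H G D b hD hGH hb hDG
    set x : X := ∑ i ∈ H, b i • e i with hx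
    obtain ⟨E, hHE, hEW, ⟨j, hj, hEj⟩, hE⟩ := hsep H (∑ i ∈ D, w i)
      (Finset.sum_pos (fun i _ => hw i) hD)
    -- the sum over `E` without `j` is dominated by `x`
    have hstep : ‖∑ i ∈ E.erase j, (1 : 𝕜) • e i‖ ≤ (1 + M) * C / δ * ‖x‖ := by
      obtain ⟨t, ht⟩ := hasg.exists_norm_sum_add_le h hs hs1 hw (E := E.erase j)
        (hHE.mono_right (Finset.erase_subset _ _)) hGH (hEj.le.trans hDG) b hb
      rw [← hδ, ← hx, ← Finset.smul_sum] at ht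
      have h2 := hE t (fun i => if i ∈ E.erase j then (δ : 𝕜) else 0)
      have h3 : ∑ i ∈ E, (if i ∈ E.erase j then (δ : 𝕜) else 0) • e i =
          (δ : 𝕜) • ∑ i ∈ E.erase j, e i := by
        rw [Finset.smul_sum, ← Finset.sum_subset (Finset.erase_subset j E)
          (f := fun i => (if i ∈ E.erase j then (δ : 𝕜) else 0) • e i)]
        · exact Finset.sum_congr rfl fun i hi => by rw [if_pos hi]
        · intro i _ hi
          rw [if_neg hi, zero_smul]
      rw [h3] at h2
      simp only [one_smul]
      rw [div_mul_eq_mul_div, le_div_iff₀ hδ0]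
      set u : X := ∑ i ∈ H, t i • e i
      set v : X := ∑ i ∈ E.erase j, e i
      have hδv : ‖(δ : 𝕜) • v‖ = δ * ‖v‖ := by
        rw [norm_smul, RCLike.norm_ofReal, abs_of_pos hδ0]
      have h4 : ‖(δ : 𝕜) • v‖ ≤ ‖u + (δ : 𝕜) • v‖ + ‖u‖ := by
        have := norm_sub_le (u + (δ : 𝕜) • v) u
        rwa [add_sub_cancel_left] at this
      have h5 : M * ‖u + (δ : 𝕜) • v‖ ≤ M * (C * ‖x‖) := by gcongr
      rw [hδv] at h4
      linarith
    have hE1 : ‖∑ i ∈ E, (1 : 𝕜) • e i‖ ≤ ((1 + M) * C / δ + B * B) * ‖x‖ := by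
      rw [← Finset.sum_erase_add E _ hj]
      refine (norm_add_le _ _).trans ?_
      have h2 : ‖(1 : 𝕜) • e j‖ ≤ B * (B * ‖x‖) := by
        rw [one_smul]
        nlinarith [hBe j]
      linarith
    -- the sum over `D` is dominated by the sum over `E`
    have hs2 : ‖((s / 2 : ℝ) : 𝕜)‖ = s / 2 := by
      rw [RCLike.norm_ofReal, abs_of_pos (by positivity)]
    obtain ⟨v, hv⟩ := hasg.exists_norm_add_sum_le h hs hw (hHE.mono_left hDH) hEW
      (fun i => ((s / 2 : ℝ) : 𝕜) * a i) fun i hi => by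
        rw [norm_mul, hs2]
        exact mul_le_of_le_one_right (by positivity) (ha i hi)
    have hDsum : ∑ i ∈ H, (if i ∈ D then ((s / 2 : ℝ) : 𝕜) * a i else 0) • e i =
        ∑ i ∈ D, (((s / 2 : ℝ) : 𝕜) * a i) • e i := by
      rw [← Finset.sum_subset hDH]
      · exact Finset.sum_congr rfl fun i hi => by rw [if_pos hi]
      · intro i _ hi
        rw [if_neg hi, zero_smul]
    have h2 := hE (fun i => if i ∈ D then ((s / 2 : ℝ) : 𝕜) * a i else 0) v
    rw [hDsum] at h2
    have h3 : s / 2 * ‖∑ i ∈ D, a i • e i‖ ≤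
        M * (C * (((1 + M) * C / δ + B * B) * ‖x‖)) := by
      calc _ = ‖∑ i ∈ D, (((s / 2 : ℝ) : 𝕜) * a i) • e i‖ := by
            simp only [mul_smul, ← Finset.smul_sum]
            rw [norm_smul, hs2]
        _ ≤ _ := h2
        _ ≤ M * (C * ‖∑ i ∈ E, (1 : 𝕜) • e i‖) := by gcongr
        _ ≤ _ := by gcongr
    calc ‖∑ i ∈ D, a i • e i‖ = 2 / s * (s / 2 * ‖∑ i ∈ D, a i • e i‖) := by field_simp
      _ ≤ 2 / s * (M * (C * (((1 + M) * C / δ + B * B) * ‖x‖))) := by gcongr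
      _ = L * ‖x‖ := by rw [hL]; ring

theorem LargeCoordDomination.norm_sum_le_of_sum_le_nsmul {K B : ℝ}
    (hK : LargeCoordDomination e f w K) (hw : ∀ i, 0 < w i) (hK0 : 0 ≤ K) (hB : 0 ≤ B)
    (hBe : ∀ i, ‖e i‖ ≤ B) (hBf : ∀ i, ‖f i‖ ≤ B) (n : ℕ) (x : X) (G : Finset ℕ) (a : ℕ → 𝕜)
    (c : ℝ) (hc : 0 < c) (hG : ∀ i ∈ G, c ≤ ‖f i x‖) (D : Finset ℕ) (ha : ∀ i ∈ D, ‖a i‖ ≤ c)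
    (hDG : ∑ i ∈ D, w i ≤ n * ∑ i ∈ G, w i) :
    ‖∑ i ∈ D, a i • e i‖ ≤ n * (K + B * B) * ‖x‖ := by
  classical
  induction n generalizing D with
  | zero =>
    have hD : D = ∅ := by
      by_contra hne
      have := Finset.sum_pos (fun i _ => hw i) (Finset.nonempty_iff_ne_empty.2 hne)
      simp at hDG
      linarith
    simp [hD]
  | succ n ih =>
    push_cast at hDG ⊢
    have hn : 0 ≤ n * (K + B * B) * ‖x‖ := by positivity
    have hBx : 0 ≤ B * B * ‖x‖ := by positivity
    by_cases hle : ∑ i ∈ D, w i ≤ ∑ i ∈ G, w i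
    · have := hK x D G a c hc hG ha hle
      linarith
    · obtain ⟨D', hD', hmax⟩ := Finset.exists_max_image
        (D.powerset.filter fun F => ∑ i ∈ F, w i ≤ ∑ i ∈ G, w i) Finset.card
        ⟨∅, by simpa using Finset.sum_nonneg fun i _ => (hw i).le⟩
      obtain ⟨hsub, hwD'⟩ := Finset.mem_filter.1 hD'
      rw [Finset.mem_powerset] at hsub
      obtain ⟨j, hjD, hjD'⟩ : ∃ j ∈ D, j ∉ D' := by
        by_contra! hcon
        exact hle (Finset.Subset.antisymm hsub hcon ▸ hwD')
      have hcross : ∑ i ∈ G, w i < ∑ i ∈ insert j D', w i := by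
        by_contra! hcon
        have h1 := hmax (insert j D') (Finset.mem_filter.2
          ⟨Finset.mem_powerset.2 (Finset.insert_subset hjD hsub), hcon⟩)
        rw [Finset.card_insert_of_notMem hjD'] at h1
        omega
      have hins : insert j D' ⊆ D := Finset.insert_subset hjD hsub
      have hrest := ih (D \ insert j D') (fun i hi => ha i (Finset.mem_sdiff.1 hi).1) (by
        have := Finset.sum_sdiff hins (f := w)
        linarith)
      have hfirst := hK x D' G a c hc hG (fun i hi => ha i (hsub hi)) hwD'
      have hGne : G.Nonempty := by
        rw [Finset.nonempty_iff_ne_empty]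
        rintro rfl
        have := Finset.sum_pos (fun i _ => hw i) ⟨j, hjD⟩
        simp at hDG
        linarith
      obtain ⟨k, hk⟩ := hGne
      have hcx := le_mul_norm_of_le_apply hBf (hG k hk)
      have hj : ‖a j • e j‖ ≤ (B * ‖x‖) * B := by
        rw [norm_smul]
        exact mul_le_mul ((ha j hjD).trans hcx) (hBe j) (norm_nonneg _) (by positivity)
      rw [← Finset.sum_sdiff hins, Finset.sum_insert hjD']
      have h1 := norm_add_le (∑ i ∈ D \ insert j D', a i • e i)
        (a j • e j + ∑ i ∈ D', a i • e i)
      have h2 := norm_add_le (a j • e j) (∑ i ∈ D', a i • e i)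
      linarith

theorem LargeCoordDomination.of_equiv {w' : ℕ → ℝ} {K c₁ c₂ : ℝ}
    (hK : LargeCoordDomination e f w K) (h : IsMarkushevichBasis e f) (hK0 : 0 ≤ K)
    (hw : ∀ i, 0 < w i) (hc₁ : 0 < c₁) (hequiv : ∀ n, c₁ * w n ≤ w' n ∧ w' n ≤ c₂ * w n) :
    ∃ K' : ℝ, 0 ≤ K' ∧ LargeCoordDomination e f w' K' := by
  obtain ⟨B, hB, hBe, hBf⟩ := h.exists_bound
  obtain ⟨n, hn⟩ := exists_nat_ge (c₂ / c₁)
  refine ⟨n * (K + B * B), by positivity, fun x D G a c hc hG hD hDG => ?_⟩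
  refine hK.norm_sum_le_of_sum_le_nsmul hw hK0 hB.le hBe hBf n x G a c hc hG D hD ?_
  have h1 : c₁ * ∑ i ∈ D, w i ≤ ∑ i ∈ D, w' i := by
    rw [Finset.mul_sum]
    exact Finset.sum_le_sum fun i _ => (hequiv i).1
  have h2 : ∑ i ∈ G, w' i ≤ c₂ * ∑ i ∈ G, w i := by
    rw [Finset.mul_sum]
    exact Finset.sum_le_sum fun i _ => (hequiv i).2
  have h3 : 0 ≤ ∑ i ∈ G, w i := Finset.sum_nonneg fun i _ => (hw i).le
  rw [div_le_iff₀ hc₁] at hn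
  refine le_of_mul_le_mul_left ?_ hc₁
  nlinarith

/-- Almost best approximations from a finite dimensional subspace exist. -/
theorem exists_norm_sub_le_two_mul (V : Submodule 𝕜 X) [FiniteDimensional 𝕜 V] (x : X) :
    ∃ y ∈ V, ∀ z ∈ V, ‖x - y‖ ≤ 2 * ‖x - z‖ := by
  have hclosed : IsClosed (V : Set X) := V.closed_of_finiteDimensional
  have hne : (V : Set X).Nonempty := ⟨0, V.zero_mem⟩
  by_cases hx : x ∈ V
  · exact ⟨x, hx, fun z _ => by simp⟩
  · have hd : 0 < Metric.infDist x V := (hclosed.notMem_iff_infDist_pos hne).1 hx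
    obtain ⟨y, hy, hlt⟩ := (Metric.infDist_lt_iff hne).1
      (show Metric.infDist x V < 2 * Metric.infDist x V by linarith)
    refine ⟨y, hy, fun z hz => ?_⟩
    have h1 := Metric.infDist_le_dist_of_mem (x := x) hz
    rw [dist_eq_norm] at h1 hlt
    linarith

theorem LargeCoordDomination.almostSemiGreedy {K s : ℝ} (hK : LargeCoordDomination e f w K)
    (h : IsMarkushevichBasis e f) (hK0 : 0 ≤ K) (hw : ∀ i, 0 < w i) (hs1 : s ≤ 1) :
    AlmostSemiGreedy e f w (2 * (1 + K)) s := by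
  classical
  intro x m
  obtain ⟨A, hA⟩ := h.exists_greedySet x m
  set V : Submodule 𝕜 X := Submodule.span 𝕜 (e '' A) with hV
  have : FiniteDimensional 𝕜 V :=
    FiniteDimensional.span_of_finite 𝕜 (A.finite_toSet.image e)
  obtain ⟨y, hyV, hy⟩ := exists_norm_sub_le_two_mul V x
  refine ⟨A, hA.mono hs1, y, fun i hi => ?_, fun B hB => ?_⟩
  · by_contra hiA
    refine hi (?_ : f i y = 0)
    have hle : V ≤ LinearMap.ker (f i : X →ₗ[𝕜] 𝕜) := by
      refine Submodule.span_le.2 ?_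
      rintro _ ⟨j, hj, rfl⟩
      have hij : i ≠ j := fun hij => hiA (hij ▸ hj)
      simp [h.biorth, hij]
    exact hle hyV
  · rw [wsum_le_wsum_iff hw] at hB
    have hz : ∑ i ∈ B ∩ A, f i x • e i ∈ V :=
      V.sum_mem fun i hi => V.smul_mem _
        (Submodule.subset_span ⟨i, (Finset.mem_inter.1 hi).2, rfl⟩)
    have hwBA : ∑ i ∈ B \ A, w i ≤ ∑ i ∈ A \ B, w i := by
      have h1 := Finset.sum_inter_add_sum_sdiff B A w
      have h2 := Finset.sum_inter_add_sum_sdiff A B w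
      rw [Finset.inter_comm] at h2
      linarith
    have hsplit : x - ∑ i ∈ B ∩ A, f i x • e i =
        (x - proj e f B x) + ∑ i ∈ B \ A, f i x • e i := by
      rw [proj, ← Finset.sum_inter_add_sum_sdiff B A]
      abel
    have hdom : ‖∑ i ∈ B \ A, f i x • e i‖ ≤ K * ‖x - proj e f B x‖ := by
      by_cases h0 : ∀ i ∈ B \ A, f i x = 0
      · rw [Finset.sum_eq_zero fun i hi => by rw [h0 i hi, zero_smul], norm_zero]
        positivity
      · push Not at h0
        obtain ⟨k, hk, hk0⟩ := h0
        obtain ⟨l, hl, hmax⟩ := Finset.exists_max_image (B \ A) (fun i => ‖f i x‖) ⟨k, hk⟩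
        refine hK _ _ (A \ B) (fun i => f i x) ‖f l x‖
          ((norm_pos_iff.2 hk0).trans_le (hmax k hk)) (fun i hi => ?_) hmax hwBA
        obtain ⟨hiA, hiB⟩ := Finset.mem_sdiff.1 hi
        rw [proj, map_sub, h.apply_sum, if_neg hiB, sub_zero]
        simpa using hA.2 i hiA l (Finset.mem_sdiff.1 hl).2
    calc ‖x - y‖ ≤ 2 * ‖x - ∑ i ∈ B ∩ A, f i x • e i‖ := hy _ hz
      _ ≤ 2 * (‖x - proj e f B x‖ + K * ‖x - proj e f B x‖) := by
          rw [hsplit]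
          gcongr
          exact (norm_add_le _ _).trans (by gcongr)
      _ = 2 * (1 + K) * ‖x - proj e f B x‖ := by ring

theorem AlmostSemiGreedy.exists_of_equiv [CompleteSpace X] {w' : ℕ → ℝ} {C s c₁ c₂ : ℝ}
    (hasg : AlmostSemiGreedy e f w C s) (h : IsMarkushevichBasis e f) (hC : 0 < C)
    (hs : 0 < s) (hs1 : s ≤ 1) (hw : ∀ i, 0 < w i) (hw' : ∀ i, 0 < w' i) (hc₁ : 0 < c₁)
    (hequiv : ∀ n, c₁ * w n ≤ w' n ∧ w' n ≤ c₂ * w n) :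
    ∃ K : ℝ, 0 < K ∧ AlmostSemiGreedy e f w' K s := by
  obtain ⟨K, hK0, hK⟩ := hasg.exists_largeCoordDomination h hC hs hs1 hw
  obtain ⟨K', hK0', hK'⟩ := hK.of_equiv h hK0 hw hc₁ hequiv
  exact ⟨2 * (1 + K'), by positivity, hK'.almostSemiGreedy h hK0' hw' hs1⟩

end Domination

/-- the almost semi-greedy property is invariant under equivalent weights. -/
theorem statement7 {𝕜 : Type*} [RCLike 𝕜] {X : Type*} [NormedAddCommGroup X]
    [NormedSpace 𝕜 X] [CompleteSpace X]
    (e : ℕ → X) (f : ℕ → X →L[𝕜] 𝕜) (hbasis : IsMarkushevichBasis e f)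
    (s : ℝ) (hs0 : 0 < s) (hs1 : s ≤ 1)
    (w w' : ℕ → ℝ) (hw : ∀ i, 0 < w i) (hw' : ∀ i, 0 < w' i)
    (c₁ c₂ : ℝ) (hc₁ : 0 < c₁) (hc₁₂ : c₁ ≤ c₂)
    (hequiv : ∀ n, c₁ * w n ≤ w' n ∧ w' n ≤ c₂ * w n) :
    (∃ K : ℝ, 0 < K ∧ AlmostSemiGreedy e f w K s) ↔
      (∃ K : ℝ, 0 < K ∧ AlmostSemiGreedy e f w' K s) := by
  have hc₂ : 0 < c₂ := hc₁.trans_le hc₁₂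
  constructor
  · rintro ⟨K, hK, hasg⟩
    exact hasg.exists_of_equiv hbasis hK hs0 hs1 hw hw' hc₁ hequiv
  · rintro ⟨K, hK, hasg⟩
    refine hasg.exists_of_equiv (c₁ := c₂⁻¹) (c₂ := c₁⁻¹) hbasis hK hs0 hs1 hw' hw
      (inv_pos.2 hc₂) fun n => ⟨?_, ?_⟩
    · rw [inv_mul_le_iff₀ hc₂]
      exact (hequiv n).2
    · rw [← div_eq_inv_mul, le_div_iff₀' hc₁]
      exact (hequiv n).1

end GreedyPaper
end
end

section
/- Let ℬ be a Markushevich basis of 𝕏 having the FDSP with constant M, fix 0 < s ≤ 1, 0 < t ≤ 1 and m ∈ ℕ, set n := ⌊(m+1)/2⌋, and suppose L > 0 is such that for every x ∈ 𝕏 there exist A ∈ 𝒢(x,2n,s) and y ∈ 𝕏 with supp(y) ⊆ A and ‖x − y‖ ≤ L·σ_{2n}(x). Then for every x ∈ 𝕏 and every A ∈ 𝒢(x,m,t), ‖x − P_A(x)‖ ≤ M·L·(1 + 2L·t⁻¹s⁻²)·‖x‖. In particular, if ℬ is C-s-weak semi-greedy, then ℬ is M·C·(1 + 2C·s⁻²)-suppression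 quasi-greedy. -/
open scoped BigOperators ENNReal
open Filter

noncomputable section

namespace GreedyPaper

variable {𝕜 : Type*} [RCLike 𝕜] {X : Type*} [NormedAddCommGroup X] [NormedSpace 𝕜 X]

/-- The `i`-th coordinate of a finite combination of basis vectors. -/
theorem IsMarkushevichBasis.coord_sum {e : ℕ → X} {f : ℕ → X →L[𝕜] 𝕜}
    (h : IsMarkushevichBasis e f) (B : Finset ℕ) (c : ℕ → 𝕜) (i : ℕ) :
    f i (∑ b ∈ B, c b • e b) = if i ∈ B then c i else 0 := by
  simp [map_sum, h.biorth]

/-- A vector supported in a finite set is equal to its projection on this set. -/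
theorem IsMarkushevichBasis.proj_eq_self {e : ℕ → X} {f : ℕ → X →L[𝕜] 𝕜}
    (h : IsMarkushevichBasis e f) {A : Finset ℕ} {y : X} (hy : msupp f y ⊆ (A : Set ℕ)) :
    proj e f A y = y := by
  rw [← sub_eq_zero]
  refine h.total _ fun i => ?_
  rw [map_sub, proj, h.coord_sum]
  by_cases hi : i ∈ A
  · simp [hi]
  · have : f i y = 0 := by
      by_contra h0
      exact hi (hy h0)
    simp [hi, this]

/-- A finite combination of basis vectors has finite support, of size at most the number of
terms. -/
theorem IsMarkushevichBasis.msupp_sum {e : ℕ → X} {f : ℕ → X →L[𝕜] 𝕜}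
    (h : IsMarkushevichBasis e f) (B : Finset ℕ) (c : ℕ → 𝕜) :
    (msupp f (∑ b ∈ B, c b • e b)).Finite ∧
      (msupp f (∑ b ∈ B, c b • e b)).ncard ≤ B.card := by
  have hsub : msupp f (∑ b ∈ B, c b • e b) ⊆ (B : Set ℕ) := by
    intro i hi
    by_contra hB
    refine hi ?_
    rw [h.coord_sum, if_neg (by simpa using hB)]
  refine ⟨B.finite_toSet.subset hsub, ?_⟩
  have := Set.ncard_le_ncard hsub B.finite_toSet
  rwa [Set.ncard_coe_finset] at this

theorem IsMarkushevichBasis.exists_norm_coord_le {e : ℕ → X} {f : ℕ → X →L[𝕜] 𝕜}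
    (h : IsMarkushevichBasis e f) : ∃ K : ℝ, 0 < K ∧ ∀ i x, ‖f i x‖ ≤ K * ‖x‖ := by
  obtain ⟨K, hK⟩ := h.bddF
  refine ⟨max K 1, by positivity, fun i x => (f i).le_of_opNorm_le ?_ x⟩
  exact (hK ⟨i, rfl⟩).trans (le_max_left _ _)

/-- The coordinates of a vector tend to zero. -/
theorem IsMarkushevichBasis.eventually_norm_coord_lt {e : ℕ → X} {f : ℕ → X →L[𝕜] 𝕜}
    (h : IsMarkushevichBasis e f) (x : X) {δ : ℝ} (hδ : 0 < δ) :
    ∃ N : ℕ, ∀ i, N ≤ i → ‖f i x‖ < δ := by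
  obtain ⟨K, hK, hf⟩ := h.exists_norm_coord_le
  obtain ⟨p, hp, hxp⟩ := Metric.dense_iff.1 h.dense_span x (δ / K) (by positivity)
  obtain ⟨N, hN⟩ : ∃ N : ℕ, ∀ i, N ≤ i → f i p = 0 := by
    refine Submodule.span_induction (p := fun v _ => ∃ N : ℕ, ∀ i, N ≤ i → f i v = 0)
      ?_ ?_ ?_ ?_ hxp
    · rintro _ ⟨j, rfl⟩
      refine ⟨j + 1, fun i hi => ?_⟩
      rw [h.biorth, if_neg (by lia)]
    · exact ⟨0, by simp⟩
    · rintro a b _ _ ⟨N, hN⟩ ⟨N', hN'⟩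
      refine ⟨max N N', fun i hi => ?_⟩
      rw [map_add, hN i (le_of_max_le_left hi), hN' i (le_of_max_le_right hi), add_zero]
    · rintro c a _ ⟨N, hN⟩
      exact ⟨N, fun i hi => by rw [map_smul, hN i hi, smul_zero]⟩
  refine ⟨N, fun i hi => ?_⟩
  have hx : ‖p - x‖ < δ / K := by simpa [dist_eq_norm] using hp
  calc ‖f i x‖ = ‖f i (p - x)‖ := by rw [map_sub, hN i hi, zero_sub, norm_neg]
    _ ≤ K * ‖p - x‖ := hf i _
    _ < K * (δ / K) := by gcongr
    _ = δ := by field_simp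

/-- The constant of the separation property is at least one. -/
theorem FDSP.one_le {e : ℕ → X} {f : ℕ → X →L[𝕜] 𝕜} (h : IsMarkushevichBasis e f) {M : ℝ}
    (hM : FDSP (𝕜 := 𝕜) e M) : 1 ≤ M := by
  refine le_of_forall_pos_le_add fun ε hε => ?_
  obtain ⟨k, -, hk, -⟩ := hM ⊥ (by simp)
    (by simpa using (Set.countable_singleton (0 : X)).isSeparable) ε hε
  have hpos : 0 < ‖e (k 0)‖ := by
    rw [norm_pos_iff]
    intro h0
    simpa [h0] using h.biorth (k 0) (k 0)
  have := hk (fun _ => 1) 0 0 le_rfl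
  simp only [zero_add, Finset.range_one, one_smul, Finset.sum_singleton] at this
  exact le_of_mul_le_mul_right (by simpa using this) hpos

theorem IsMarkushevichBasis.isSeparable_univ {e : ℕ → X} {f : ℕ → X →L[𝕜] 𝕜}
    (h : IsMarkushevichBasis e f) : TopologicalSpace.IsSeparable (Set.univ : Set X) := by
  rw [← h.dense_span.closure_eq]
  exact ((Set.countable_range e).isSeparable.span (R := 𝕜)).closure

/-- The separation property for one finite-dimensional subspace, with the separating
subsequence chosen so that the coordinates of a given vector along it are small. -/
theorem FDSP.exists_separated {e : ℕ → X} {f : ℕ → X →L[𝕜] 𝕜} (h : IsMarkushevichBasis e f)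
    {M : ℝ} (hM : FDSP (𝕜 := 𝕜) e M) {ε δ : ℝ} (hε : 0 < ε) (hδ : 0 < δ) (x v : X) :
    ∃ κ : ℕ → ℕ, StrictMono κ ∧ (∀ q, ‖f (κ q) x‖ < δ) ∧
      ∀ z ∈ Submodule.span 𝕜 (Set.range (e ∘ κ)), ‖v‖ ≤ (M + ε) * ‖v + z‖ := by
  obtain ⟨k, hk, -, hsep⟩ := hM ⊤ (by simp) (by simpa using h.isSeparable_univ) ε hε
  obtain ⟨N, hN⟩ := hsep (Submodule.span 𝕜 {v}) le_top inferInstance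
  obtain ⟨N', hN'⟩ := h.eventually_norm_coord_lt x hδ
  refine ⟨fun q => k (N + N' + 1 + q), fun a b hab => hk (by lia), fun q => hN' _ ?_,
    fun z hz => hN v (Submodule.mem_span_singleton_self v) z (subset_closure ?_)⟩
  · have := hk.id_le (N + N' + 1 + q)
    simp only [id] at this
    lia
  · refine Submodule.span_mono ?_ hz
    rintro _ ⟨q, rfl⟩
    exact ⟨N + N' + 1 + q, by lia, rfl⟩

/-- Every vector has an `s`-greedy set of size `N` carrying an approximation which is, up to the
factor `L`, as good as the best `N`-term approximation. -/
def ChebyshevGreedy (f : ℕ → X →L[𝕜] 𝕜) (L s : ℝ) (N : ℕ) : Prop :=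
  ∀ x : X, ∃ A : Finset ℕ, GreedySet f x N s A ∧
    ∃ y : X, msupp f y ⊆ (A : Set ℕ) ∧
      ∀ z : X, (msupp f z).Finite → (msupp f z).ncard ≤ N → ‖x - y‖ ≤ L * ‖x - z‖

/-- Approximating `x + μ ∑_{b ∈ B} e b`, where the coordinates of `x` on `A` dominate `μ` and
those on `B` are small, changes at most one of the coefficients on `B`. -/
theorem ChebyshevGreedy.exists_flat_block {e : ℕ → X} {f : ℕ → X →L[𝕜] 𝕜}
    (h : IsMarkushevichBasis e f) {L s K : ℝ} {N : ℕ} (hL : ChebyshevGreedy f L s N)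
    (hs0 : 0 < s) (hK0 : 0 ≤ K) (hK : ∀ i x, ‖f i x‖ ≤ K * ‖x‖)
    {x : X} {A B S : Finset ℕ} {α μ δ : ℝ} (hμ : 0 < μ) (hμα : μ + δ < s * α)
    (hAcard : N ≤ A.card + 1) (hBcard : B.card = N)
    (hA : ∀ a ∈ A, α ≤ ‖f a x‖) (hB : ∀ b ∈ B, ‖f b x‖ < δ)
    (hAB : Disjoint A B) (hSB : Disjoint S B) (hS : ∀ k, s * (μ - δ) ≤ ‖f k x‖ → k ∈ S) :
    ∃ c d : ℕ → 𝕜, ‖x - ∑ k ∈ S, d k • e k + ∑ b ∈ B, c b • e b‖ ≤ L * ‖x‖ ∧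
      (∀ k ∈ S, ‖d k‖ ≤ K * (1 + L) * ‖x‖) ∧
      ∃ G ⊆ B, N ≤ G.card + 1 ∧ ∀ g ∈ G, c g = (μ : 𝕜) := by
  set v : X := x + ∑ b ∈ B, (μ : 𝕜) • e b with hv
  have hfv : ∀ k, f k v = f k x + if k ∈ B then (μ : 𝕜) else 0 := fun k => by
    rw [hv, map_add, h.coord_sum B fun _ => (μ : 𝕜)]
  have hfB : ∀ k ∈ B, f k v = f k x + μ := fun k hk => by rw [hfv, if_pos hk]
  have hfB' : ∀ k ∉ B, f k v = f k x := fun k hk => by rw [hfv, if_neg hk, add_zero]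
  have hμn : ‖(μ : 𝕜)‖ = μ := by simp [abs_of_pos hμ]
  obtain ⟨D, ⟨hDcard, hD⟩, y, hyD, hy⟩ := hL v
  have hDS : ∀ k ∈ D, k ∉ B → k ∈ S := by
    intro k hkD hkB
    obtain ⟨b, hbB, hbD⟩ : ∃ b ∈ B, b ∉ D := by
      by_contra! hsub
      have : B = D := Finset.eq_of_subset_of_card_le hsub (by rw [hDcard, hBcard])
      exact hkB (this ▸ hkD)
    refine hS k ?_
    have h1 := hD k hkD b hbD
    rw [hfB b hbB, hfB' k hkB] at h1
    refine le_trans ?_ h1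
    gcongr
    have h2 := norm_sub_le (f b x + (μ : 𝕜)) (f b x)
    rw [add_sub_cancel_left, hμn] at h2
    linarith [hB b hbB]
  have hysupp : msupp f y ⊆ ((S ∪ B : Finset ℕ) : Set ℕ) := by
    intro k hk
    have := hyD hk
    by_cases hkB : k ∈ B
    · simp [hkB]
    · simp [hDS k this hkB]
  have hyeq := h.proj_eq_self hysupp
  rw [proj, Finset.sum_union hSB] at hyeq
  have hvy : ‖v - y‖ ≤ L * ‖x‖ := by
    have hz := h.msupp_sum B fun _ => (μ : 𝕜)
    simpa [hv] using hy _ hz.1 (hz.2.trans hBcard.le)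
  refine ⟨fun b => μ - f b y, fun k => f k y, ?_, ?_, B \ D, Finset.sdiff_subset, ?_, ?_⟩
  · refine le_of_eq_of_le (congrArg norm ?_) hvy
    simp only [sub_smul, Finset.sum_sub_distrib]
    rw [hv]
    nth_rewrite 3 [← hyeq]
    abel
  · intro k hk
    have hkB : k ∉ B := Finset.disjoint_left.1 hSB hk
    have h1 := hK k (v - y)
    rw [map_sub, hfB' k hkB] at h1
    have h2 := norm_sub_le (f k x) (f k x - f k y)
    rw [sub_sub_cancel] at h2
    have h3 := hK k x
    have h4 : K * ‖v - y‖ ≤ K * (L * ‖x‖) := by gcongr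
    linarith
  · have hinter : (B ∩ D).card ≤ 1 := by
      by_cases hne : (B ∩ D).Nonempty
      · obtain ⟨b, hb⟩ := hne
        obtain ⟨hbB, hbD⟩ := Finset.mem_inter.1 hb
        have hAD : A ⊆ D := by
          intro a ha
          by_contra haD
          have h1 := hD b hbD a haD
          rw [hfB b hbB, hfB' a (Finset.disjoint_left.1 hAB ha)] at h1
          have h2 : s * α ≤ s * ‖f a x‖ := by
            gcongr
            exact hA a ha
          have h3 := norm_add_le (f b x) (μ : 𝕜)
          rw [hμn] at h3
          linarith [hB b hbB]
        have hdisj : Disjoint A (B ∩ D) := hAB.mono_right Finset.inter_subset_left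
        have h1 := Finset.card_le_card
          (Finset.union_subset hAD (Finset.inter_subset_right (s₁ := B)))
        rw [Finset.card_union_of_disjoint hdisj, hDcard] at h1
        lia
      · simp [Finset.not_nonempty_iff_eq_empty.1 hne]
    have := Finset.card_sdiff_add_card_inter B D
    lia
  · intro g hg
    have hgD := (Finset.mem_sdiff.1 hg).2
    have : f g y = 0 := by
      by_contra h0
      exact hgD (hyD h0)
    simp [this]

/-- Along a subsequence on which the coordinates of `x` are small there is a vector of norm
essentially at most `2 * L * ‖x‖` having at least `N` coefficients of modulus `μ`. -/
theorem ChebyshevGreedy.exists_small_flat {e : ℕ → X} {f : ℕ → X →L[𝕜] 𝕜}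
    (h : IsMarkushevichBasis e f) {L s : ℝ} {N : ℕ} (hL : ChebyshevGreedy f L s N)
    (hN : 2 ≤ N) (hs0 : 0 < s) (hs1 : s ≤ 1) {x : X} {A : Finset ℕ} {α μ δ ε : ℝ} (hμ : 0 < μ)
    (hε : 0 < ε) (hδ : 2 * δ < s * μ) (hμα : μ + δ < s * α) (hAcard : N ≤ A.card + 1)
    (hA : ∀ a ∈ A, α ≤ ‖f a x‖) {κ : ℕ → ℕ} (hκ : StrictMono κ)
    (hκx : ∀ q, ‖f (κ q) x‖ < δ) :
    ∃ (B : Finset ℕ) (c : ℕ → 𝕜), (B : Set ℕ) ⊆ Set.range κ ∧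
      ‖∑ b ∈ B, c b • e b‖ ≤ 2 * L * ‖x‖ + ε ∧
      ∃ G ⊆ B, N ≤ G.card ∧ ∀ g ∈ G, ‖c g‖ = μ := by
  obtain ⟨K, hK0, hK⟩ := h.exists_norm_coord_le
  have hδ0 : 0 < δ := (norm_nonneg _).trans_lt (hκx 0)
  have hsδ : s * δ ≤ δ := by nlinarith
  have hδα : δ < α := by nlinarith
  have hδS : δ < s * (μ - δ) := by linarith
  obtain ⟨P, hP⟩ := h.eventually_norm_coord_lt x (hδ0.trans hδS)
  set S : Finset ℕ := (Finset.range P).filter fun k => s * (μ - δ) ≤ ‖f k x‖ with hSdef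
  have hS : ∀ k, s * (μ - δ) ≤ ‖f k x‖ → k ∈ S := by
    intro k hk
    refine Finset.mem_filter.2 ⟨Finset.mem_range.2 ?_, hk⟩
    by_contra! hPk
    exact (hP k hPk).not_ge hk
  set B : ℕ → Finset ℕ := fun i => (Finset.Ico (i * N) (i * N + N)).image κ with hBdef
  have hBsmall : ∀ i, ∀ b ∈ B i, ‖f b x‖ < δ := by
    intro i b hb
    obtain ⟨q, -, rfl⟩ := Finset.mem_image.1 hb
    exact hκx q
  have hblock : ∀ i, ∃ c d : ℕ → 𝕜,
      ‖x - ∑ k ∈ S, d k • e k + ∑ b ∈ B i, c b • e b‖ ≤ L * ‖x‖ ∧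
      (∀ k ∈ S, ‖d k‖ ≤ K * (1 + L) * ‖x‖) ∧
      ∃ G ⊆ B i, N ≤ G.card + 1 ∧ ∀ g ∈ G, c g = (μ : 𝕜) := by
    intro i
    refine hL.exists_flat_block h hs0 hK0.le hK hμ hμα hAcard ?_ hA (hBsmall i) ?_ ?_ hS
    · rw [hBdef, Finset.card_image_of_injective _ hκ.injective]
      simp
    · refine Finset.disjoint_left.2 fun a ha hb => ?_
      linarith [hA a ha, hBsmall i a hb]
    · refine Finset.disjoint_left.2 fun a ha hb => ?_
      linarith [(Finset.mem_filter.1 ha).2, hBsmall i a hb]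
  choose c d hcd hd G hGB hGcard hG using hblock
  obtain ⟨i, j, hij, hclose⟩ : ∃ i j, i < j ∧
      ‖∑ k ∈ S, d i k • e k - ∑ k ∈ S, d j k • e k‖ < ε := by
    let T : (S → 𝕜) → X := fun a => ∑ k : S, a k • e k
    have hT : Continuous T := by fun_prop
    have hcomp := (isCompact_closedBall (0 : S → 𝕜) (max (K * (1 + L) * ‖x‖) 0)).image hT
    have hmem : ∀ i, ∑ k ∈ S, d i k • e k ∈
        T '' Metric.closedBall (0 : S → 𝕜) (max (K * (1 + L) * ‖x‖) 0) := by
      intro i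
      refine ⟨fun k => d i k, ?_, Finset.sum_coe_sort S fun k => d i k • e k⟩
      rw [mem_closedBall_zero_iff, pi_norm_le_iff_of_nonneg (le_max_right _ _)]
      exact fun k => (hd i k k.2).trans (le_max_left _ _)
    obtain ⟨a, -, φ, hφ, hlim⟩ := hcomp.tendsto_subseq hmem
    obtain ⟨n₀, hn₀⟩ := Metric.cauchySeq_iff.1 hlim.cauchySeq ε hε
    refine ⟨φ n₀, φ (n₀ + 1), hφ (by lia), ?_⟩
    simpa [dist_eq_norm] using hn₀ n₀ le_rfl (n₀ + 1) (by lia)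
  have hdisj : Disjoint (B i) (B j) := by
    refine Finset.disjoint_left.2 fun b hbi hbj => ?_
    obtain ⟨q, hq, rfl⟩ := Finset.mem_image.1 hbi
    obtain ⟨q', hq', hqq⟩ := Finset.mem_image.1 hbj
    obtain rfl := hκ.injective hqq
    rw [Finset.mem_Ico] at hq hq'
    have : (i + 1) * N ≤ j * N := Nat.mul_le_mul_right N hij
    rw [add_mul, one_mul] at this
    lia
  have hnotmem : ∀ b ∈ B j, b ∉ B i := fun b hb hb' => Finset.disjoint_left.1 hdisj hb' hb
  refine ⟨B i ∪ B j, fun b => if b ∈ B i then c i b else - c j b, ?_, ?_, G i ∪ G j,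
    Finset.union_subset_union (hGB i) (hGB j), ?_, ?_⟩
  · intro b hb
    rcases Finset.mem_union.1 hb with hb | hb <;>
    · obtain ⟨q, -, rfl⟩ := Finset.mem_image.1 hb
      exact ⟨q, rfl⟩
  · have h1 : ∑ b ∈ B i ∪ B j, (if b ∈ B i then c i b else - c j b) • e b =
        (x - ∑ k ∈ S, d i k • e k + ∑ b ∈ B i, c i b • e b) -
        (x - ∑ k ∈ S, d j k • e k + ∑ b ∈ B j, c j b • e b) +
        (∑ k ∈ S, d i k • e k - ∑ k ∈ S, d j k • e k) := by
      rw [Finset.sum_union hdisj,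
        Finset.sum_congr rfl fun b hb => by rw [if_pos hb],
        Finset.sum_congr (s₁ := B j) rfl fun b hb => by rw [if_neg (hnotmem b hb), neg_smul],
        Finset.sum_neg_distrib]
      abel
    rw [h1]
    refine (norm_add_le _ _).trans ?_
    have h2 := norm_sub_le (x - ∑ k ∈ S, d i k • e k + ∑ b ∈ B i, c i b • e b)
      (x - ∑ k ∈ S, d j k • e k + ∑ b ∈ B j, c j b • e b)
    linarith [hcd i, hcd j]
  · rw [Finset.card_union_of_disjoint (hdisj.mono (hGB i) (hGB j))]
    have := hGcard i
    have := hGcard j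
    lia
  · have hμn : ‖(μ : 𝕜)‖ = μ := by simp [abs_of_pos hμ]
    intro g hg
    beta_reduce
    rcases Finset.mem_union.1 hg with hg | hg
    · rw [if_pos (hGB i hg), hG i g hg, hμn]
    · rw [if_neg (hnotmem g (hGB j hg)), hG j g hg, norm_neg, hμn]

/-- Removing a greedy set costs at most the norm of `x + w` for any separated vector `w` with
sufficiently many large coefficients. -/
theorem ChebyshevGreedy.norm_sub_proj_le {e : ℕ → X} {f : ℕ → X →L[𝕜] 𝕜}
    (h : IsMarkushevichBasis e f) {L s : ℝ} {N : ℕ} (hL : ChebyshevGreedy f L s N)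
    (hs0 : 0 < s) {x : X} {A B G : Finset ℕ} {c : ℕ → 𝕜} {β γ δ R : ℝ} (hβ : 0 ≤ β)
    (hR : 0 ≤ R) (hγ : β < s * (γ - δ)) (hAcard : A.card ≤ N) (hA : ∀ k ∉ A, ‖f k x‖ ≤ β)
    (hB : ∀ b ∈ B, ‖f b x‖ < δ) (hAB : Disjoint A B) (hGB : G ⊆ B) (hGcard : N ≤ G.card)
    (hG : ∀ g ∈ G, γ ≤ ‖c g‖)
    (hsep : ∀ z ∈ Submodule.span 𝕜 (e '' B),
      ‖x - proj e f A x‖ ≤ R * ‖x - proj e f A x + z‖) :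
    ‖x - proj e f A x‖ ≤ R * (L * ‖x + ∑ b ∈ B, c b • e b‖) := by
  set w : X := ∑ b ∈ B, c b • e b with hw
  set u : X := x - proj e f A x + w with hu
  have hfu : ∀ k, f k u =
      f k x - (if k ∈ A then f k x else 0) + if k ∈ B then c k else 0 := fun k => by
    rw [hu, hw, proj, map_add, map_sub, h.coord_sum B,
      h.coord_sum A fun i => f i x]
  obtain ⟨D, ⟨hDcard, hD⟩, y, hyD, hy⟩ := hL u
  have hDB : D ⊆ B := by
    intro k hkD
    by_contra hkB
    obtain ⟨g, hgG, hgD⟩ : ∃ g ∈ G, g ∉ D := by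
      by_contra! hsub
      have : G = D := Finset.eq_of_subset_of_card_le hsub (by rw [hDcard]; exact hGcard)
      exact hkB (hGB (this ▸ hkD))
    have h1 := hD k hkD g hgD
    have hgB := hGB hgG
    have hk : ‖f k u‖ ≤ β := by
      rw [hfu, if_neg hkB, add_zero]
      split_ifs with hkA
      · simpa using hβ
      · simpa using hA k hkA
    have hg : γ - δ ≤ ‖f g u‖ := by
      rw [hfu, if_pos hgB, if_neg (Finset.disjoint_right.1 hAB hgB), sub_zero]
      have h2 := norm_sub_le (f g x + c g) (f g x)
      rw [add_sub_cancel_left] at h2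
      linarith [hB g hgB, hG g hgG]
    have h3 : s * (γ - δ) ≤ s * ‖f g u‖ := by gcongr
    linarith
  have hspan : ∀ a : ℕ → 𝕜, ∑ b ∈ B, a b • e b ∈ Submodule.span 𝕜 (e '' B) := fun a =>
    Submodule.sum_mem _ fun b hb => Submodule.smul_mem _ _ (Submodule.subset_span ⟨b, hb, rfl⟩)
  have hyB : y ∈ Submodule.span 𝕜 (e '' B) := by
    rw [← h.proj_eq_self (hyD.trans (Finset.coe_subset.2 hDB))]
    exact hspan _
  have h1 := hsep (w - y) (Submodule.sub_mem _ (hspan c) hyB)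
  refine h1.trans ?_
  gcongr
  have hz := h.msupp_sum A fun i => - f i x
  have h2 := hy _ hz.1 (hz.2.trans hAcard)
  have h3 : x - proj e f A x + (w - y) = u - y := by
    rw [hu]
    abel
  have h4 : x + w = u - ∑ i ∈ A, (-f i x) • e i := by
    simp only [hu, proj, neg_smul, Finset.sum_neg_distrib]
    abel
  rwa [h3, h4]

/-- The estimate for the removal of a weak greedy set, up to arbitrarily small errors. -/
theorem ChebyshevGreedy.norm_sub_proj_le_of_lt {e : ℕ → X} {f : ℕ → X →L[𝕜] 𝕜}
    (h : IsMarkushevichBasis e f) {M : ℝ} (hM : FDSP (𝕜 := 𝕜) e M) {L s t : ℝ} {N m : ℕ}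
    (hL : ChebyshevGreedy f L s N) (hL0 : 0 < L) (hN : 2 ≤ N) (hmN : m ≤ N) (hNm : N ≤ m + 1)
    (hs0 : 0 < s) (hs1 : s ≤ 1) (ht0 : 0 < t) {x : X} {A : Finset ℕ}
    (hA : GreedySet f x m t A) {r ε : ℝ} (hr : t⁻¹ * s⁻¹ ^ 2 < r) (hε : 0 < ε) :
    ‖x - proj e f A x‖ ≤ (M + ε) * (L * (‖x‖ + r * (2 * L * ‖x‖ + ε))) := by
  obtain ⟨hAcard, hAt⟩ := hA
  have hM1 := hM.one_le h
  have hr0 : 0 < r := lt_trans (by positivity) hr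
  obtain ⟨a₀, ha₀, hmin⟩ := A.exists_min_image (fun a => ‖f a x‖) (Finset.card_pos.1 (by lia))
  set α : ℝ := ‖f a₀ x‖ with hα
  have hβ : ∀ k ∉ A, ‖f k x‖ ≤ t⁻¹ * α := fun k hk => by
    rw [inv_mul_eq_div, le_div_iff₀ ht0, mul_comm]
    exact hAt a₀ ha₀ k hk
  rcases (norm_nonneg (f a₀ x)).eq_or_lt with h0 | hα0
  · have hsupp : msupp f x ⊆ (A : Set ℕ) := by
      intro k hk
      by_contra hkA
      refine hk (norm_le_zero_iff.1 ((hβ k hkA).trans ?_))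
      rw [hα, ← h0, mul_zero]
    rw [h.proj_eq_self hsupp, sub_self, norm_zero]
    positivity
  rw [← hα] at hα0
  obtain ⟨μ, hμ1, hμ2⟩ : ∃ μ, t⁻¹ * α / (r * s) < μ ∧ μ < s * α := by
    refine exists_between ?_
    rw [div_lt_iff₀ (by positivity)]
    have h1 : t⁻¹ < r * s ^ 2 := by
      have := mul_lt_mul_of_pos_right hr (show 0 < s ^ 2 by positivity)
      rwa [mul_assoc, ← mul_pow, inv_mul_cancel₀ hs0.ne', one_pow, mul_one] at this
    nlinarith
  have hμ0 : 0 < μ := lt_trans (by positivity) hμ1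
  rw [div_lt_iff₀ (by positivity)] at hμ1
  obtain ⟨δ, hδ0, hδ⟩ : ∃ δ, 0 < δ ∧
      δ < min (s * μ / 2) (min (s * α - μ) (μ * (r * s) - t⁻¹ * α)) := by
    refine exists_between (lt_min (by positivity) (lt_min ?_ ?_)) <;> linarith
  rw [lt_min_iff, lt_min_iff] at hδ
  obtain ⟨hδ1, hδ2, hδ3⟩ := hδ
  have hsδ : s * δ ≤ δ := by nlinarith
  obtain ⟨κ, hκ, hκx, hsep⟩ := hM.exists_separated h hε hδ0 x (x - proj e f A x)
  obtain ⟨B, c, hBκ, hw, G, hGB, hGcard, hG⟩ :=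
    hL.exists_small_flat h hN hs0 hs1 (α := α) hμ0 hε (by linarith) (by linarith)
      (by lia) hmin hκ hκx
  have hBx : ∀ b ∈ B, ‖f b x‖ < δ := by
    intro b hb
    obtain ⟨q, rfl⟩ := hBκ hb
    exact hκx q
  have hmain := hL.norm_sub_proj_le h hs0 (c := fun b => (r : 𝕜) * c b) (β := t⁻¹ * α)
    (γ := r * μ) (δ := δ) (R := M + ε) (by positivity) (by linarith) (by linarith)
    (hAcard.trans_le hmN) hβ hBx ?_ hGB hGcard ?_ ?_
  · refine hmain.trans ?_
    have h1 : ‖∑ b ∈ B, ((r : 𝕜) * c b) • e b‖ = r * ‖∑ b ∈ B, c b • e b‖ := by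
      simp only [mul_smul, ← Finset.smul_sum, norm_smul]
      simp [abs_of_pos hr0]
    gcongr
    refine (norm_add_le _ _).trans ?_
    rw [h1]
    gcongr
  · refine Finset.disjoint_left.2 fun a ha hb => ?_
    have h1 := hmin a ha
    have h2 := hBx a hb
    nlinarith
  · intro g hg
    rw [norm_mul, hG g hg]
    simp [abs_of_pos hr0]
  · intro z hz
    refine hsep z (Submodule.span_mono ?_ hz)
    rintro _ ⟨b, hb, rfl⟩
    obtain ⟨q, rfl⟩ := hBκ hb
    exact ⟨q, rfl⟩

/-- Removing a weak greedy set of size `m` is bounded if best approximation of order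
`2 * ⌊(m + 1) / 2⌋` is realized, up to a constant, by weak greedy sets. -/
theorem ChebyshevGreedy.suppression {e : ℕ → X} {f : ℕ → X →L[𝕜] 𝕜}
    (h : IsMarkushevichBasis e f) {M : ℝ} (hM : FDSP (𝕜 := 𝕜) e M) {L s t : ℝ} {m : ℕ}
    (hL : ChebyshevGreedy f L s (2 * ((m + 1) / 2))) (hL0 : 0 < L)
    (hs0 : 0 < s) (hs1 : s ≤ 1) (ht0 : 0 < t) {x : X} {A : Finset ℕ}
    (hA : GreedySet f x m t A) :
    ‖x - proj e f A x‖ ≤ M * L * (1 + 2 * L * t⁻¹ * s⁻¹ ^ 2) * ‖x‖ := by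
  rcases Nat.eq_zero_or_pos m with rfl | hm
  · have hM1 := hM.one_le h
    obtain ⟨D, ⟨hD, -⟩, y, hyD, hy⟩ := hL x
    have hA0 : A = ∅ := Finset.card_eq_zero.1 hA.1
    have hD0 : D = ∅ := Finset.card_eq_zero.1 (by simpa using hD)
    have hy0 : y = 0 := by
      rw [← h.proj_eq_self hyD, hD0]
      simp [proj]
    have h1 : ‖x‖ ≤ L * ‖x‖ := by
      simpa [hy0] using hy 0 (by simp [msupp]) (by simp [msupp])
    have h2 : (0 : ℝ) ≤ 2 * L * t⁻¹ * s⁻¹ ^ 2 := by positivity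
    have h3 : 1 ≤ M * (1 + 2 * L * t⁻¹ * s⁻¹ ^ 2) := by nlinarith
    have h4 : 0 ≤ L * ‖x‖ := by positivity
    have h5 : ‖x - proj e f A x‖ = ‖x‖ := by simp [hA0, proj]
    nlinarith
  · have hlim : Tendsto
        (fun ε : ℝ => (M + ε) * (L * (‖x‖ + (t⁻¹ * s⁻¹ ^ 2 + ε) * (2 * L * ‖x‖ + ε))))
        (nhdsWithin 0 (Set.Ioi 0))
        (nhds ((M + 0) * (L * (‖x‖ + (t⁻¹ * s⁻¹ ^ 2 + 0) * (2 * L * ‖x‖ + 0))))) := by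
      refine Tendsto.mono_left (Continuous.tendsto ?_ 0) nhdsWithin_le_nhds
      fun_prop
    have h1 := ge_of_tendsto hlim (b := ‖x - proj e f A x‖) (by
      filter_upwards [self_mem_nhdsWithin] with ε hε
      exact hL.norm_sub_proj_le_of_lt h hM hL0 (by lia) (by lia) (by lia) hs0 hs1 ht0 hA
        (lt_add_of_pos_right _ hε) hε)
    refine h1.trans_eq ?_
    ring

/-- suppression quasi-greediness from the lower Chebyshevian Lebesgue parameter. -/
theorem statement9 {𝕜 : Type*} [RCLike 𝕜] {X : Type*} [NormedAddCommGroup X]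
    [NormedSpace 𝕜 X] [CompleteSpace X]
    (e : ℕ → X) (f : ℕ → X →L[𝕜] 𝕜) (hbasis : IsMarkushevichBasis e f)
    (M : ℝ) (hfdsp : FDSP (𝕜 := 𝕜) e M)
    (s t : ℝ) (hs0 : 0 < s) (hs1 : s ≤ 1) (ht0 : 0 < t) (ht1 : t ≤ 1)
    (m : ℕ) (L : ℝ) (hL : 0 < L)
    (happrox : ∀ x : X, ∃ A : Finset ℕ, GreedySet f x (2 * ((m + 1) / 2)) s A ∧
      ∃ y : X, msupp f y ⊆ (A : Set ℕ) ∧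
        ∀ z : X, (msupp f z).Finite → (msupp f z).ncard ≤ 2 * ((m + 1) / 2) →
          ‖x - y‖ ≤ L * ‖x - z‖) :
    (∀ (x : X) (A : Finset ℕ), GreedySet f x m t A →
      ‖x - proj e f A x‖ ≤ M * L * (1 + 2 * L * t⁻¹ * s⁻¹ ^ 2) * ‖x‖) ∧
    (∀ C : ℝ, 0 < C →
      (∀ (x : X) (m' : ℕ), ∃ A : Finset ℕ, GreedySet f x m' s A ∧
        ∃ y : X, msupp f y ⊆ (A : Set ℕ) ∧
          ∀ z : X, (msupp f z).Finite → (msupp f z).ncard ≤ m' → ‖x - y‖ ≤ C * ‖x - z‖) →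
      ∀ (x : X) (m' : ℕ) (A : Finset ℕ), GreedySet f x m' 1 A →
        ‖x - proj e f A x‖ ≤ M * C * (1 + 2 * C * s⁻¹ ^ 2) * ‖x‖) := by
  refine ⟨fun x A hA => ?_, fun C hC hsemi x m' A hA => ?_⟩
  · exact ChebyshevGreedy.suppression hbasis hfdsp happrox hL hs0 hs1 ht0 hA
  · have hCheb : ChebyshevGreedy f C s (2 * ((m' + 1) / 2)) := fun v => hsemi v _
    simpa using hCheb.suppression hbasis hfdsp hC hs0 hs1 one_pos hA

end GreedyPaper
end
end
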